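/- arXiv:1809.07460 — 6 statements merged into one kernel-verified Lean document; each statement's English description precedes it below -/
import Mathlib

section
/- Let X > 0 be a strictly positive random variable with E[sin(tX)] ≥ 0 for all t ≥ 0, and let Y > 0 be a random variable with probability density function g(t) = (2/π)·E[sin(tX)]/t for t > 0. If E[X^s] < ∞ for all s ∈ (−1,1), then E[Y^{−s}] = E[X^s] / (Γ(s+1)·cos(sπ/2)) holds for every s ∈ (−1,1). -/
open MeasureTheory Real Set Filter

lemma aux_gam {p q b : ℝ} (hp : 0 < p) (hq : -1 < q) (hb : 0 < b) :
    ∫⁻ x in Ioi (0:ℝ), ENNReal.ofReal (x ^ q * rexp (-b * x ^ p))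
      = ENNReal.ofReal (b ^ (-(q + 1) / p) * (1 / p) * Gamma ((q + 1) / p)) := by
  rw [← integral_rpow_mul_exp_neg_mul_rpow hp hq hb]
  refine (ofReal_integral_eq_lintegral_ofReal
    (integrableOn_rpow_mul_exp_neg_mul_rpow hq hp hb) ?_).symm
  filter_upwards [ae_restrict_mem measurableSet_Ioi] with x hx
  have : (0:ℝ) < x := hx
  positivity

lemma aux_gam1 {q b : ℝ} (hq : -1 < q) (hb : 0 < b) :
    ∫⁻ x in Ioi (0:ℝ), ENNReal.ofReal (x ^ q * rexp (-b * x))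
      = ENNReal.ofReal (b ^ (-(q + 1)) * Gamma (q + 1)) := by
  have := aux_gam one_pos hq hb
  simpa using this

lemma aux_gam2 {q b : ℝ} (hq : -1 < q) (hb : 0 < b) :
    ∫⁻ x in Ioi (0:ℝ), ENNReal.ofReal (x ^ q * rexp (-b * x ^ 2))
      = ENNReal.ofReal (b ^ (-(q + 1) / 2) * (1 / 2) * Gamma ((q + 1) / 2)) := by
  have := aux_gam two_pos hq hb
  simpa using this

lemma aux_beta {s x : ℝ} (hs : s ∈ Ioo (-1 : ℝ) 1) (hx : 0 < x) :
    ∫⁻ u in Ioi (0:ℝ), ENNReal.ofReal (u ^ s * (x / (u ^ 2 + x ^ 2)))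
      = ENNReal.ofReal (x ^ s * (π / (2 * cos (s * π / 2)))) := by
  obtain ⟨h1, h2⟩ := hs
  have e1 : ∀ u ∈ Ioi (0:ℝ), ENNReal.ofReal (u ^ s * (x / (u ^ 2 + x ^ 2)))
      = ∫⁻ v in Ioi (0:ℝ), ENNReal.ofReal (x * rexp (-x^2 * v) * (u ^ s * rexp (-v * u ^ 2))) := by
    intro u hu
    have hu : 0 < u := hu
    have hb : 0 < u ^ 2 + x ^ 2 := by positivity
    have := aux_gam1 (q := 0) (by norm_num) hb
    calc _ = ENNReal.ofReal (x * u ^ s) * ENNReal.ofReal ((u ^ 2 + x ^ 2) ^ (-(0 + 1) : ℝ) * Gamma (0 + 1)) := by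
          rw [← ENNReal.ofReal_mul (by positivity)]
          congr 1
          simp [rpow_neg_one]
          ring
      _ = _ := by
          rw [← this, ← lintegral_const_mul' _ _ ENNReal.ofReal_ne_top]
          refine lintegral_congr fun v => ?_
          rw [← ENNReal.ofReal_mul (by positivity)]
          congr 1
          have : rexp (-(u ^ 2 + x ^ 2) * v) = rexp (-x^2 * v) * rexp (-v * u ^ 2) := by
            rw [← Real.exp_add]; ring_nf
          rw [this]; simp; ring
  rw [setLIntegral_congr_fun measurableSet_Ioi e1, lintegral_lintegral_swap (by fun_prop)]
  have e2 : ∀ v ∈ Ioi (0:ℝ),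
      ∫⁻ u in Ioi (0:ℝ), ENNReal.ofReal (x * rexp (-x^2 * v) * (u ^ s * rexp (-v * u ^ 2)))
      = ENNReal.ofReal (x * (1 / 2) * Gamma ((s + 1) / 2)) *
        ENNReal.ofReal (v ^ (-(s + 1) / 2) * rexp (-x^2 * v)) := by
    intro v hv
    have hv : 0 < v := hv
    have hG : 0 < Gamma ((s + 1) / 2) := Gamma_pos_of_pos (by linarith)
    simp_rw [ENNReal.ofReal_mul (show 0 ≤ x * rexp (-x^2 * v) by positivity)]
    rw [lintegral_const_mul' _ _ ENNReal.ofReal_ne_top, aux_gam2 h1 hv,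
      ← ENNReal.ofReal_mul (by positivity), ← ENNReal.ofReal_mul (by positivity)]
    congr 1
    ring
  have hG : 0 < Gamma ((s + 1) / 2) := Gamma_pos_of_pos (by linarith)
  rw [setLIntegral_congr_fun measurableSet_Ioi e2, lintegral_const_mul' _ _ ENNReal.ofReal_ne_top,
    aux_gam1 (by linarith) (by positivity), ← ENNReal.ofReal_mul (by positivity)]
  congr 1
  have r := Real.Gamma_mul_Gamma_one_sub ((s + 1) / 2)
  have c : sin (π * ((s + 1) / 2)) = cos (s * π / 2) := by
    rw [← Real.sin_add_pi_div_two]; congr 1; ring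
  have g : -(s + 1) / 2 + 1 = 1 - (s + 1) / 2 := by ring
  have p : (x ^ 2) ^ (-(1 - (s + 1) / 2)) * x = x ^ s := by
    rw [← rpow_natCast, ← rpow_mul hx.le]
    nth_rw 2 [← rpow_one x]
    rw [← rpow_add hx]; congr 1; push_cast; ring
  rw [c] at r
  rw [g, ← p]
  calc _ = (x ^ 2) ^ (-(1 - (s + 1) / 2)) * x * (1/2) * (Gamma ((s + 1) / 2) * Gamma (1 - (s + 1) / 2)) := by ring
    _ = _ := by rw [r]; field_simp

lemma aux_lap {u x : ℝ} (hu : 0 < u) (hx : 0 < x) :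
    ∫ t in Ioi (0:ℝ), rexp (-u * t) * sin (t * x) = x / (u ^ 2 + x ^ 2) := by
  have hb : 0 < u ^ 2 + x ^ 2 := by positivity
  have hi : IntegrableOn (fun t => rexp (-u * t) * sin (t * x)) (Ioi 0) := by
    refine (exp_neg_integrableOn_Ioi 0 hu).mono' (by fun_prop) (ae_of_all _ fun t => ?_)
    rw [norm_mul, Real.norm_of_nonneg (Real.exp_pos _).le]
    exact mul_le_of_le_one_right (Real.exp_pos _).le (Real.abs_sin_le_one _)
  have hE : Tendsto (fun t => rexp (-u * t)) atTop (nhds 0) := by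
    refine Real.tendsto_exp_atBot.comp ?_
    exact tendsto_id.const_mul_atTop_of_neg (by linarith)
  have := integral_Ioi_of_hasDerivAt_of_tendsto' (a := 0) (m := 0)
    (f := fun t => rexp (-u * t) * (-(u * sin (t * x) + x * cos (t * x)) / (u ^ 2 + x ^ 2)))
    (f' := fun t => rexp (-u * t) * sin (t * x)) ?_ hi ?_
  · rw [this]; simp; ring
  · intro t _
    have a1 : HasDerivAt (fun t : ℝ => t * x) x t := by simpa using (hasDerivAt_id t).mul_const x
    have a2 : HasDerivAt (fun t : ℝ => -u * t) (-u) t := by simpa using (hasDerivAt_id t).const_mul (-u)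
    refine (a2.exp.mul ((((a1.sin.const_mul u).add (a1.cos.const_mul x)).neg).div_const (u ^ 2 + x ^ 2))).congr_deriv ?_
    simp only [Pi.neg_apply, Pi.add_apply]
    field_simp
    ring
  · refine hE.zero_mul_isBoundedUnder_le ?_
    refine isBoundedUnder_of ⟨(u + x) / (u ^ 2 + x ^ 2), fun t => ?_⟩
    simp only [Function.comp, norm_div, norm_neg, Real.norm_of_nonneg hb.le]
    gcongr
    refine (norm_add_le _ _).trans (add_le_add ?_ ?_)
    · rw [norm_mul, Real.norm_of_nonneg hu.le]
      exact mul_le_of_le_one_right hu.le (Real.abs_sin_le_one _)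
    · rw [norm_mul, Real.norm_of_nonneg hx.le]
      exact mul_le_of_le_one_right hx.le (Real.abs_cos_le_one _)

set_option maxHeartbeats 1000000 in
theorem stmt7 {Ω Ω' : Type*} [MeasurableSpace Ω] [MeasurableSpace Ω']
    (μ : Measure Ω) (ν : Measure Ω') [IsProbabilityMeasure μ] [IsProbabilityMeasure ν]
    (X : Ω → ℝ) (Y : Ω' → ℝ) (hX : Measurable X) (hY : Measurable Y)
    (hXpos : ∀ ω, 0 < X ω) (hYpos : ∀ ω, 0 < Y ω)
    (hsin : ∀ t : ℝ, 0 ≤ t → 0 ≤ ∫ ω, Real.sin (t * X ω) ∂μ)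
    (hdens : Measure.map Y ν
      = volume.withDensity
          (fun t => ENNReal.ofReal
            (if 0 < t then 2 / π * (∫ ω, Real.sin (t * X ω) ∂μ) / t else 0)))
    (hint : ∀ s ∈ Ioo (-1 : ℝ) 1, Integrable (fun ω => X ω ^ s) μ) :
    ∀ s ∈ Ioo (-1 : ℝ) 1,
      ∫ ω, Y ω ^ (-s) ∂ν
        = (∫ ω, X ω ^ s ∂μ) / (Real.Gamma (s + 1) * Real.cos (s * π / 2)) := by
  intro s hs
  have hs1 := hs.1
  have hs2 := hs.2
  have hG : 0 < Gamma (s + 1) := Gamma_pos_of_pos (by linarith)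
  have hc : 0 < cos (s * π / 2) := by
    apply cos_pos_of_mem_Ioo
    constructor <;> nlinarith [pi_pos]
  set S : ℝ → ℝ := fun t => ∫ ω, Real.sin (t * X ω) ∂μ with hS
  have hSm : Measurable S := by
    refine (StronglyMeasurable.integral_prod_right (f := fun t ω => Real.sin (t * X ω)) ?_).measurable
    apply Measurable.stronglyMeasurable
    unfold Function.uncurry
    fun_prop
  have hdm : Measurable (fun t => ENNReal.ofReal (if 0 < t then 2 / π * S t / t else 0)) := by
    refine ENNReal.measurable_ofReal.comp (Measurable.ite measurableSet_Ioi ?_ measurable_const)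
    fun_prop
  -- Laplace transform of `S`
  have hL : ∀ u ∈ Ioi (0:ℝ), ∫⁻ t in Ioi (0:ℝ), ENNReal.ofReal (rexp (-u * t) * S t)
      = ∫⁻ ω, ENNReal.ofReal (X ω / (u ^ 2 + X ω ^ 2)) ∂μ := by
    intro u hu
    have hu : 0 < u := hu
    have hI : Integrable (Function.uncurry fun (t : ℝ) (ω : Ω) => rexp (-u * t) * sin (t * X ω))
        ((volume.restrict (Ioi (0:ℝ))).prod μ) := by
      have := (Integrable.mul_prod (exp_neg_integrableOn_Ioi 0 hu) (integrable_const (1:ℝ) (μ := μ)))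
      refine this.mono' ?_ (ae_of_all _ fun t => ?_)
      · unfold Function.uncurry
        exact Measurable.aestronglyMeasurable (by fun_prop)
      · simp only [Function.uncurry]
        rw [norm_mul, Real.norm_of_nonneg (Real.exp_pos _).le]
        exact mul_le_mul_of_nonneg_left (Real.abs_sin_le_one _) (Real.exp_pos _).le
    have hI1 : Integrable (fun t => rexp (-u * t) * S t) (volume.restrict (Ioi (0:ℝ))) := by
      have := hI.integral_prod_left
      simpa only [Function.uncurry, integral_const_mul] using this
    have e3 : ∀ t : ℝ, ∫ ω, rexp (-u * t) * sin (t * X ω) ∂μ = rexp (-u * t) * S t :=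
      fun t => integral_const_mul _ _
    have e4 : ∀ ω, ∫ t in Ioi (0:ℝ), rexp (-u * t) * sin (t * X ω) = X ω / (u ^ 2 + X ω ^ 2) :=
      fun ω => aux_lap hu (hXpos ω)
    have hI2 : Integrable (fun ω => X ω / (u ^ 2 + X ω ^ 2)) μ := by
      have := hI.integral_prod_right
      simp only [Function.uncurry, e4] at this
      exact this
    have n1 : 0 ≤ᵐ[volume.restrict (Ioi (0:ℝ))] fun t => rexp (-u * t) * S t := by
      filter_upwards [ae_restrict_mem measurableSet_Ioi] with t ht
      exact mul_nonneg (Real.exp_pos _).le (hsin t (le_of_lt ht))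
    have n2 : 0 ≤ᵐ[μ] fun ω => X ω / (u ^ 2 + X ω ^ 2) := by
      refine ae_of_all _ fun ω => ?_
      have := hXpos ω
      simp only [Pi.zero_apply]
      positivity
    have e5 : ∫ t in Ioi (0:ℝ), rexp (-u * t) * S t = ∫ ω, X ω / (u ^ 2 + X ω ^ 2) ∂μ := by
      have := integral_integral_swap hI
      simp_rw [e3, e4] at this
      exact this
    exact (ofReal_integral_eq_lintegral_ofReal hI1 n1).symm.trans
      ((congrArg ENNReal.ofReal e5).trans (ofReal_integral_eq_lintegral_ofReal hI2 n2))
  have key : ∫⁻ ω, ENNReal.ofReal (Y ω ^ (-s)) ∂ν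
      = ENNReal.ofReal (1 / (Gamma (s + 1) * cos (s * π / 2))) *
        ∫⁻ ω, ENNReal.ofReal (X ω ^ s) ∂μ := by
    calc ∫⁻ ω, ENNReal.ofReal (Y ω ^ (-s)) ∂ν
        = ∫⁻ t, ENNReal.ofReal (t ^ (-s)) ∂(Measure.map Y ν) := by
          rw [lintegral_map (by fun_prop) hY]
      _ = ∫⁻ t, (Ioi (0:ℝ)).indicator (fun t => ENNReal.ofReal (2 / π * S t / t * t ^ (-s))) t := by
          rw [hdens, lintegral_withDensity_eq_lintegral_mul _ hdm (by fun_prop)]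
          refine lintegral_congr fun t => ?_
          simp only [Pi.mul_apply, indicator, mem_Ioi]
          split_ifs with ht
          · rw [ENNReal.ofReal_mul]
            have := hsin t ht.le
            positivity
          · simp
      _ = ∫⁻ t in Ioi (0:ℝ), ENNReal.ofReal (2 / π * S t / t * t ^ (-s)) :=
          lintegral_indicator measurableSet_Ioi _
      _ = ∫⁻ t in Ioi (0:ℝ), ∫⁻ u in Ioi (0:ℝ), ENNReal.ofReal (2 / π / Gamma (s + 1)) *
            ENNReal.ofReal (u ^ s * (rexp (-u * t) * S t)) := by
          refine setLIntegral_congr_fun measurableSet_Ioi fun t ht => ?_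
          have ht : 0 < t := ht
          have hSt : 0 ≤ S t := hsin t ht.le
          have e : ∀ u : ℝ, ENNReal.ofReal (2 / π / Gamma (s + 1)) *
              ENNReal.ofReal (u ^ s * (rexp (-u * t) * S t))
              = ENNReal.ofReal (2 / π / Gamma (s + 1) * S t) *
                ENNReal.ofReal (u ^ s * rexp (-t * u)) := by
            intro u
            rw [← ENNReal.ofReal_mul (by positivity), ← ENNReal.ofReal_mul (by positivity)]
            congr 1
            rw [show -u * t = -t * u by ring]; ring
          simp_rw [e]
          rw [lintegral_const_mul' _ _ ENNReal.ofReal_ne_top, aux_gam1 hs1 ht,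
            ← ENNReal.ofReal_mul (by positivity)]
          congr 1
          have : t ^ (-(s + 1)) = t ^ (-s) / t := by
            rw [← rpow_sub_one ht.ne']; congr 1; ring
          rw [this]
          field_simp
      _ = ∫⁻ u in Ioi (0:ℝ), ∫⁻ t in Ioi (0:ℝ), ENNReal.ofReal (2 / π / Gamma (s + 1)) *
            ENNReal.ofReal (u ^ s * (rexp (-u * t) * S t)) :=
          lintegral_lintegral_swap (Measurable.aemeasurable (by unfold Function.uncurry; fun_prop))
      _ = ∫⁻ u in Ioi (0:ℝ), ∫⁻ ω, ENNReal.ofReal (2 / π / Gamma (s + 1)) *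
            ENNReal.ofReal (u ^ s * (X ω / (u ^ 2 + X ω ^ 2))) ∂μ := by
          refine setLIntegral_congr_fun measurableSet_Ioi fun u hu => ?_
          have hu' : 0 < u := hu
          simp_rw [ENNReal.ofReal_mul (show 0 ≤ u ^ s by positivity)]
          simp only [lintegral_const_mul' _ _ ENNReal.ofReal_ne_top, hL u hu]
      _ = ∫⁻ ω, (∫⁻ u in Ioi (0:ℝ), ENNReal.ofReal (2 / π / Gamma (s + 1)) *
            ENNReal.ofReal (u ^ s * (X ω / (u ^ 2 + X ω ^ 2)))) ∂μ :=
          lintegral_lintegral_swap (Measurable.aemeasurable (by unfold Function.uncurry; fun_prop))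
      _ = _ := by
          rw [← lintegral_const_mul' _ _ ENNReal.ofReal_ne_top]
          refine lintegral_congr fun ω => ?_
          rw [lintegral_const_mul' _ _ ENNReal.ofReal_ne_top, aux_beta hs (hXpos ω),
            ← ENNReal.ofReal_mul (by positivity), ← ENNReal.ofReal_mul (by positivity)]
          congr 1
          field_simp
  rw [integral_eq_lintegral_of_nonneg_ae (ae_of_all _ fun ω => (rpow_pos_of_pos (hYpos ω) _).le)
      (Measurable.aestronglyMeasurable (by fun_prop)),
    integral_eq_lintegral_of_nonneg_ae (ae_of_all _ fun ω => (rpow_pos_of_pos (hXpos ω) _).le)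
      (Measurable.aestronglyMeasurable (by fun_prop)), key, ENNReal.toReal_mul,
    ENNReal.toReal_ofReal (by positivity)]
  ring
end

section
/- Let φ: ℝ → ℝ be an even, continuous function with φ(0) = 1, which is nonincreasing and convex on [0,∞) and satisfies lim_{t→∞} φ(t) = 0 (a Pólya-type characteristic function vanishing at infinity). Let Z be a real random variable whose characteristic function is φ, and let X > 0 be a random variable with distribution function F(x) = 1 − φ(x) for x ≥ 0. If E[X^s] < ∞ for all s ∈ (−1,1), then E[|Z|^{−s}] = E[X^s] / (Γ(s+1)·cos(sπ/2)) for every s with |s| < 1. -/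
open MeasureTheory Real Set Filter

lemma lgam {p q b : ℝ} (hp : 0 < p) (hq : -1 < q) (hb : 0 < b) :
    ∫⁻ x in Ioi (0:ℝ), ENNReal.ofReal (x ^ q * exp (-b * x ^ p)) =
      ENNReal.ofReal (b ^ (-(q + 1) / p) * (1 / p) * Gamma ((q + 1) / p)) := by
  rw [← integral_rpow_mul_exp_neg_mul_rpow hp hq hb, ofReal_integral_eq_lintegral_ofReal]
  · exact integrableOn_rpow_mul_exp_neg_mul_rpow hq hp hb
  · refine (ae_restrict_mem measurableSet_Ioi).mono fun x hx => ?_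
    have : 0 < x := hx
    simp only [Pi.zero_apply]; positivity

lemma lgam1 {q b : ℝ} (hq : -1 < q) (hb : 0 < b) :
    ∫⁻ x in Ioi (0:ℝ), ENNReal.ofReal (x ^ q * exp (-b * x)) =
      ENNReal.ofReal (b ^ (-(q + 1)) * Gamma (q + 1)) := by
  have := lgam one_pos hq hb
  simpa using this

lemma lJ {a z : ℝ} (ha : 0 < a) (ha2 : a < 2) (hz : z ≠ 0) :
    ∫⁻ u in Ioi (0:ℝ), ENNReal.ofReal (u ^ (a - 1) / (u ^ 2 + z ^ 2)) =
      ENNReal.ofReal (|z| ^ (a - 2) * (π / (2 * sin (π * (a / 2))))) := by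
  have hz2 : 0 < z ^ 2 := by positivity
  have h1 : ∫⁻ u in Ioi (0:ℝ), ENNReal.ofReal (u ^ (a - 1) / (u ^ 2 + z ^ 2)) =
      ∫⁻ u in Ioi (0:ℝ), ∫⁻ t in Ioi (0:ℝ),
        ENNReal.ofReal (u ^ (a - 1) * exp (-(u ^ 2 + z ^ 2) * t)) := by
    refine setLIntegral_congr_fun measurableSet_Ioi fun u hu => ?_
    have hu : 0 < u := hu
    have := lgam1 (q := 0) (b := u ^ 2 + z ^ 2) (by norm_num) (by positivity)
    simp only [rpow_zero, one_mul, zero_add, Gamma_one, mul_one] at this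
    have hp : 0 ≤ u ^ (a - 1) := by positivity
    simp_rw [ENNReal.ofReal_mul hp]
    rw [lintegral_const_mul _ (by fun_prop), this, div_eq_mul_inv, ENNReal.ofReal_mul hp,
      rpow_neg_one]
  rw [h1, lintegral_lintegral_swap (by fun_prop)]
  have h2 : ∀ t ∈ Ioi (0:ℝ), ∫⁻ u in Ioi (0:ℝ),
        ENNReal.ofReal (u ^ (a - 1) * exp (-(u ^ 2 + z ^ 2) * t)) =
      ENNReal.ofReal (1 / 2 * Gamma (a / 2)) * ENNReal.ofReal (t ^ (-(a / 2)) * exp (-z ^ 2 * t)) := by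
    intro t ht
    have ht : 0 < t := ht
    have := lgam (p := 2) (q := a - 1) (b := t) (by norm_num) (by linarith) ht
    simp only [rpow_two, sub_add_cancel] at this
    have e : ∀ u : ℝ, u ^ (a - 1) * exp (-(u ^ 2 + z ^ 2) * t)
        = exp (-z ^ 2 * t) * (u ^ (a - 1) * exp (-t * u ^ 2)) := by
      intro u
      rw [mul_left_comm, ← exp_add]; ring_nf
    simp_rw [e, ENNReal.ofReal_mul (exp_pos _).le]
    rw [lintegral_const_mul _ (by fun_prop), this, ← ENNReal.ofReal_mul (exp_pos _).le,
      ← ENNReal.ofReal_mul (by have := Gamma_pos_of_pos (half_pos ha); positivity)]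
    ring_nf
  rw [setLIntegral_congr_fun measurableSet_Ioi h2, lintegral_const_mul _ (by fun_prop),
    lgam1 (by linarith) hz2, 
      ← ENNReal.ofReal_mul (by have := Gamma_pos_of_pos (half_pos ha); positivity)]
  congr 1
  have hr := Real.Gamma_mul_Gamma_one_sub (a / 2)
  have : (z ^ 2) ^ (-(-(a / 2) + 1)) = |z| ^ (a - 2) := by
    rw [← sq_abs, ← rpow_two, ← rpow_mul (abs_nonneg _)]; ring_nf
  rw [this, show -(a / 2) + 1 = 1 - a / 2 by ring, ← div_div, div_right_comm, ← hr]
  ring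

lemma core {g : ℝ → ℝ} (hg : Measurable g) (h0 : ∀ x, 0 ≤ x → 0 ≤ g x) (h1 : ∀ x, 0 ≤ x → g x ≤ 1)
    {q : ℝ} (hq : -1 < q) :
    ∫⁻ y in Ioi (0:ℝ), ENNReal.ofReal (y ^ q * ∫ x in Ioi (0:ℝ), exp (-y * x) * g x) =
      ENNReal.ofReal (Gamma (q + 1)) *
        ∫⁻ x in Ioi (0:ℝ), ENNReal.ofReal (g x) * ENNReal.ofReal (x ^ (-(q + 1))) := by
  have hG : 0 < Gamma (q + 1) := Gamma_pos_of_pos (by linarith)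
  have e1 : ∀ y ∈ Ioi (0:ℝ), ENNReal.ofReal (y ^ q * ∫ x in Ioi (0:ℝ), exp (-y * x) * g x) =
      ∫⁻ x in Ioi (0:ℝ), ENNReal.ofReal (y ^ q * (exp (-y * x) * g x)) := by
    intro y hy
    have hy : 0 < y := hy
    rw [← integral_const_mul, ofReal_integral_eq_lintegral_ofReal]
    · refine Integrable.const_mul ?_ _
      refine Integrable.mono' (exp_neg_integrableOn_Ioi 0 hy) (by fun_prop) ?_
      refine (ae_restrict_mem measurableSet_Ioi).mono fun x hx => ?_
      have hx : 0 < x := hx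
      rw [norm_of_nonneg (mul_nonneg (exp_pos _).le (h0 x hx.le))]
      exact mul_le_of_le_one_right (exp_pos _).le (h1 x hx.le)
    · refine (ae_restrict_mem measurableSet_Ioi).mono fun x hx => ?_
      have hx : 0 < x := hx
      have := h0 x hx.le
      simp only [Pi.zero_apply]; positivity
  rw [setLIntegral_congr_fun measurableSet_Ioi e1, lintegral_lintegral_swap (by fun_prop),
    ← lintegral_const_mul _ (by fun_prop)]
  refine setLIntegral_congr_fun measurableSet_Ioi fun x hx => ?_
  have hx : 0 < x := hx
  have e : ∀ y, y ^ q * (exp (-y * x) * g x) = g x * (y ^ q * exp (-x * y)) := by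
    intro y; ring_nf
  simp_rw [e, ENNReal.ofReal_mul (h0 x hx.le)]
  rw [lintegral_const_mul _ (by fun_prop), lgam1 hq hx, ENNReal.ofReal_mul (by positivity)]
  ring

lemma lapcos {y : ℝ} (hy : 0 < y) (z : ℝ) :
    ∫ x in Ioi (0:ℝ), exp (-y * x) * cos (x * z) = y / (y ^ 2 + z ^ 2) := by
  have ha : (-(y:ℂ) + z * Complex.I).re < 0 := by simpa using hy
  have h := integral_exp_mul_complex_Ioi ha 0
  have h2 := congrArg Complex.re h
  rw [← RCLike.re_to_complex, ← integral_re (integrableOn_exp_mul_complex_Ioi ha 0)] at h2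
  convert h2 using 1
  · refine setIntegral_congr_fun measurableSet_Ioi fun x hx => ?_
    simp [Complex.exp_re, mul_comm]
  · simp [Complex.normSq_apply, Complex.div_re]
    ring_nf

section
variable {Ω Ω' : Type*} [MeasurableSpace Ω] [MeasurableSpace Ω']

lemma lap (μ : Measure Ω) [IsProbabilityMeasure μ] {φ : ℝ → ℝ} {Z : Ω → ℝ} (hZ : Measurable Z)
    (hchar : ∀ t : ℝ, ∫ ω, Complex.exp (Complex.I * ((t * Z ω : ℝ) : ℂ)) ∂μ = (φ t : ℂ))
    {y : ℝ} (hy : 0 < y) :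
    ∫ x in Ioi (0:ℝ), exp (-y * x) * φ x = ∫ ω, y / (y ^ 2 + Z ω ^ 2) ∂μ := by
  have hc : ∀ t, φ t = ∫ ω, cos (t * Z ω) ∂μ := by
    intro t
    have h2 := congrArg Complex.re (hchar t)
    rw [← RCLike.re_to_complex, ← integral_re] at h2
    · simp only [RCLike.re_to_complex, Complex.ofReal_re] at h2
      rw [← h2]
      congr 1; ext ω
      rw [mul_comm, Complex.exp_ofReal_mul_I_re]
    · refine Integrable.of_bound (C := 1) (by fun_prop) (Eventually.of_forall fun ω => ?_)
      rw [mul_comm, Complex.norm_exp_ofReal_mul_I]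
  simp_rw [hc, ← integral_const_mul, ← lapcos hy]
  refine integral_integral_swap ?_
  refine Integrable.mono' (g := fun p : ℝ × Ω => exp (-y * p.1)) ?_ ?_ ?_
  · exact Integrable.comp_fst (f := fun x : ℝ => exp (-y * x)) (exp_neg_integrableOn_Ioi 0 hy) μ
  · have : Measurable (Function.uncurry fun (x : ℝ) (ω : Ω) => exp (-y * x) * cos (x * Z ω)) := by
      unfold Function.uncurry; fun_prop
    exact this.aestronglyMeasurable
  · refine Eventually.of_forall fun p => ?_
    simp only [Function.uncurry, norm_mul, norm_eq_abs, abs_exp]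
    exact mul_le_of_le_one_right (exp_pos _).le (abs_cos_le_one _)

/-- swap for the Z side -/
lemma core2 (μ : Measure Ω) [IsProbabilityMeasure μ] {Z : Ω → ℝ} (hZ : Measurable Z)
    {k : ℝ → ℝ → ℝ} (hk : Measurable (Function.uncurry k)) (C : ℝ → ℝ)
    (h0 : ∀ y z, 0 < y → 0 ≤ k y z) (h1 : ∀ y z, 0 < y → k y z ≤ C y) :
    ∫⁻ y in Ioi (0:ℝ), ENNReal.ofReal (∫ ω, k y (Z ω) ∂μ) =
      ∫⁻ ω, (∫⁻ y in Ioi (0:ℝ), ENNReal.ofReal (k y (Z ω))) ∂μ := by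
  have hm : Measurable fun p : ℝ × Ω => k p.1 (Z p.2) :=
    hk.comp (measurable_fst.prodMk (hZ.comp measurable_snd))
  rw [← lintegral_lintegral_swap (by exact hm.ennreal_ofReal.aemeasurable)]
  refine setLIntegral_congr_fun measurableSet_Ioi fun y hy => ?_
  have hy : 0 < y := hy
  refine ofReal_integral_eq_lintegral_ofReal ?_ (Eventually.of_forall fun ω => h0 _ _ hy)
  refine Integrable.of_bound (C := C y) ?_ (Eventually.of_forall fun ω => ?_)
  · exact (hm.comp measurable_prodMk_left).aestronglyMeasurable
  · rw [norm_of_nonneg (h0 _ _ hy)]; exact h1 _ _ hy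

lemma negmom (ν : Measure Ω') [IsProbabilityMeasure ν] {X : Ω' → ℝ} (hX : Measurable X)
    (hXpos : ∀ ω, 0 < X ω) {r : ℝ} (hr : 0 < r) :
    ∫⁻ x in Ioi (0:ℝ), ν {ω | X ω ≤ x} * ENNReal.ofReal (x ^ (-(r + 1))) =
      ENNReal.ofReal (1 / r) * ∫⁻ ω, ENNReal.ofReal (X ω ^ (-r)) ∂ν := by
  have hS : MeasurableSet {p : ℝ × Ω' | X p.2 ≤ p.1} :=
    measurableSet_le (hX.comp measurable_snd) measurable_fst
  have e1 : ∀ x : ℝ, ν {ω | X ω ≤ x} * ENNReal.ofReal (x ^ (-(r + 1))) =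
      ∫⁻ ω, {p : ℝ × Ω' | X p.2 ≤ p.1}.indicator (fun p => ENNReal.ofReal (p.1 ^ (-(r + 1)))) (x, ω) ∂ν := by
    intro x
    have hx : MeasurableSet {ω | X ω ≤ x} := measurableSet_le hX measurable_const
    rw [mul_comm, ← setLIntegral_const, ← lintegral_indicator hx]
    rfl
  simp_rw [e1]
  rw [lintegral_lintegral_swap
    (by exact ((by fun_prop : Measurable fun p : ℝ × Ω' => ENNReal.ofReal (p.1 ^ (-(r + 1)))).indicator
      hS).aemeasurable), ← lintegral_const_mul _ (by fun_prop)]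
  congr 1; ext ω
  have hp := hXpos ω
  have e2 : (fun x : ℝ => {p : ℝ × Ω' | X p.2 ≤ p.1}.indicator
      (fun p => ENNReal.ofReal (p.1 ^ (-(r + 1)))) (x, ω)) =
      (Ici (X ω)).indicator fun x => ENNReal.ofReal (x ^ (-(r + 1))) := rfl
  rw [e2, lintegral_indicator measurableSet_Ici, Measure.restrict_restrict measurableSet_Ici,
    inter_eq_left.2 (Ici_subset_Ioi.2 hp), setLIntegral_congr Ioi_ae_eq_Ici.symm,
    ← ofReal_integral_eq_lintegral_ofReal, integral_Ioi_rpow_of_lt (by linarith) hp,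
    ← ENNReal.ofReal_mul (by positivity)]
  · congr 1
    rw [show -(r + 1) + 1 = -r by ring, neg_div_neg_eq]; ring
  · exact integrableOn_Ioi_rpow_of_lt (by linarith) hp
  · refine (ae_restrict_mem measurableSet_Ioi).mono fun x hx => ?_
    have : 0 < x := hp.trans hx
    simp only [Pi.zero_apply]; positivity

lemma poscase (μ : Measure Ω) (ν : Measure Ω') [IsProbabilityMeasure μ] [IsProbabilityMeasure ν]
    {φ : ℝ → ℝ} (hφcont : Continuous φ) (h0 : ∀ x, 0 ≤ x → 0 ≤ φ x) (h1 : ∀ x, 0 ≤ x → φ x ≤ 1)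
    {Z : Ω → ℝ} (hZ : Measurable Z)
    (hchar : ∀ t : ℝ, ∫ ω, Complex.exp (Complex.I * ((t * Z ω : ℝ) : ℂ)) ∂μ = (φ t : ℂ))
    {X : Ω' → ℝ} (hX : Measurable X) (hXpos : ∀ ω, 0 < X ω)
    (hcdf : ∀ x : ℝ, 0 ≤ x → ν {ω | X ω ≤ x} = ENNReal.ofReal (1 - φ x))
    {s : ℝ} (hs0 : 0 < s) (hs1 : s < 1) (hint : Integrable (fun ω => X ω ^ s) ν) :
    s * ((∫ ω, |Z ω| ^ (-s) ∂μ) * (π / (2 * sin (π * ((2 - s) / 2)))))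
      = Gamma (1 - s) * ∫ ω, X ω ^ s ∂ν := by
  set J := π / (2 * sin (π * ((2 - s) / 2))) with hJ
  have hJ0 : 0 < J := by
    have : 0 < sin (π * ((2 - s) / 2)) := by
      apply sin_pos_of_pos_of_lt_pi
      · have : 0 < (2 - s) / 2 := by linarith
        positivity
      · nlinarith [pi_pos]
    positivity
  have hG : 0 < Gamma (1 - s) := Gamma_pos_of_pos (by linarith)
  have hcore := core hφcont.measurable h0 h1 (q := -s) (by linarith)
  have hlc := lintegral_rpow_eq_lintegral_meas_lt_mul ν
    (Eventually.of_forall fun ω => (hXpos ω).le) hX.aemeasurable hs0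
  have hm : ∀ t ∈ Ioi (0:ℝ), ν {a | t < X a} * ENNReal.ofReal (t ^ (s - 1)) =
      ENNReal.ofReal (φ t) * ENNReal.ofReal (t ^ (-(-s + 1))) := by
    intro t ht
    have ht : 0 < t := ht
    have : {a | t < X a} = {a | X a ≤ t}ᶜ := by ext; simp
    rw [this, prob_compl_eq_one_sub (measurableSet_le hX measurable_const), hcdf t ht.le,
      ← ENNReal.ofReal_one, ← ENNReal.ofReal_sub _ (by linarith [h1 t ht.le])]
    ring_nf
  rw [setLIntegral_congr_fun measurableSet_Ioi hm] at hlc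
  have hZside : ∫⁻ y in Ioi (0:ℝ), ENNReal.ofReal (y ^ (-s) * ∫ x in Ioi (0:ℝ), exp (-y * x) * φ x)
      = ∫⁻ ω, (∫⁻ y in Ioi (0:ℝ), ENNReal.ofReal (y ^ (-s) * (y / (y ^ 2 + Z ω ^ 2)))) ∂μ := by
    rw [← core2 μ hZ (k := fun y z => y ^ (-s) * (y / (y ^ 2 + z ^ 2)))
      (by unfold Function.uncurry; fun_prop) (fun y => y ^ (-s) * (y / y ^ 2))
      (fun y z hy => by positivity) (fun y z hy => by gcongr; nlinarith [sq_nonneg z])]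
    refine setLIntegral_congr_fun measurableSet_Ioi fun y hy => ?_
    rw [lap μ hZ hchar hy, integral_const_mul]
  rw [hZside] at hcore
  have hfin : ∫⁻ ω, ENNReal.ofReal (X ω ^ s) ∂ν ≠ ⊤ := by
    rw [← ofReal_integral_eq_lintegral_ofReal hint
      (Eventually.of_forall fun ω => (rpow_pos_of_pos (hXpos ω) _).le)]
    exact ENNReal.ofReal_ne_top
  have key : ENNReal.ofReal s *
      ∫⁻ ω, (∫⁻ y in Ioi (0:ℝ), ENNReal.ofReal (y ^ (-s) * (y / (y ^ 2 + Z ω ^ 2)))) ∂μ =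
      ENNReal.ofReal (Gamma (1 - s)) * ∫⁻ ω, ENNReal.ofReal (X ω ^ s) ∂ν := by
    rw [hcore, hlc, show -s + 1 = 1 - s by ring]; ring
  have hsne : ENNReal.ofReal s ≠ 0 := by simpa using hs0
  have hfin2 : ∫⁻ ω, (∫⁻ y in Ioi (0:ℝ), ENNReal.ofReal (y ^ (-s) * (y / (y ^ 2 + Z ω ^ 2)))) ∂μ
      ≠ ⊤ := by
    intro h
    rw [h, ENNReal.mul_top hsne] at key
    exact ENNReal.mul_ne_top ENNReal.ofReal_ne_top hfin key.symm
  have hmeas : Measurable fun ω => ∫⁻ y in Ioi (0:ℝ),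
      ENNReal.ofReal (y ^ (-s) * (y / (y ^ 2 + Z ω ^ 2))) := by
    apply Measurable.lintegral_prod_right' (f := fun p : Ω × ℝ =>
      ENNReal.ofReal (p.2 ^ (-s) * (p.2 / (p.2 ^ 2 + Z p.1 ^ 2))))
    fun_prop
  have hae := ae_lt_top hmeas hfin2
  have hI : ∀ᵐ ω ∂μ, ∫⁻ y in Ioi (0:ℝ), ENNReal.ofReal (y ^ (-s) * (y / (y ^ 2 + Z ω ^ 2)))
      = ENNReal.ofReal (|Z ω| ^ (-s)) * ENNReal.ofReal J := by
    filter_upwards [hae] with ω hω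
    have hz : Z ω ≠ 0 := by
      intro hz
      apply not_integrableOn_Ioi_rpow (-s - 1)
      refine ⟨(by fun_prop), ?_⟩
      rw [hasFiniteIntegral_iff_ofReal]
      · convert hω using 1
        refine setLIntegral_congr_fun measurableSet_Ioi fun y hy => ?_
        have hy : 0 < y := hy
        simp only [hz]
        rw [rpow_sub_one hy.ne']
        congr 1
        field_simp
        simp
      · refine (ae_restrict_mem measurableSet_Ioi).mono fun x hx => ?_
        have : 0 < x := hx
        simp only [Pi.zero_apply]; positivity
    have := lJ (a := 2 - s) (by linarith) (by linarith) hz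
    rw [← ENNReal.ofReal_mul (by positivity), show -s = 2 - s - 2 by ring, ← this]
    refine setLIntegral_congr_fun measurableSet_Ioi fun y hy => ?_
    have hy : 0 < y := hy
    rw [show 2 - s - 1 = (2 - s - 2) + 1 by ring, rpow_add_one hy.ne', mul_div_assoc]
  rw [lintegral_congr_ae hI, lintegral_mul_const _ (by fun_prop)] at key
  have key2 := congrArg ENNReal.toReal key
  simp only [ENNReal.toReal_mul, ENNReal.toReal_ofReal hs0.le, ENNReal.toReal_ofReal hJ0.le,
    ENNReal.toReal_ofReal hG.le] at key2
  rwa [← integral_eq_lintegral_of_nonneg_ae (Eventually.of_forall fun ω => by positivity)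
      (Measurable.aestronglyMeasurable (by fun_prop)), ← integral_eq_lintegral_of_nonneg_ae
      (Eventually.of_forall fun ω => (rpow_pos_of_pos (hXpos ω) _).le)
      (Measurable.aestronglyMeasurable (by fun_prop))] at key2

lemma negcase (μ : Measure Ω) (ν : Measure Ω') [IsProbabilityMeasure μ] [IsProbabilityMeasure ν]
    {φ : ℝ → ℝ} (hφcont : Continuous φ) (h0 : ∀ x, 0 ≤ x → 0 ≤ φ x) (h1 : ∀ x, 0 ≤ x → φ x ≤ 1)
    {Z : Ω → ℝ} (hZ : Measurable Z)
    (hchar : ∀ t : ℝ, ∫ ω, Complex.exp (Complex.I * ((t * Z ω : ℝ) : ℂ)) ∂μ = (φ t : ℂ))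
    {X : Ω' → ℝ} (hX : Measurable X) (hXpos : ∀ ω, 0 < X ω)
    (hcdf : ∀ x : ℝ, 0 ≤ x → ν {ω | X ω ≤ x} = ENNReal.ofReal (1 - φ x))
    {r : ℝ} (hr0 : 0 < r) (hr1 : r < 1) :
    (∫ ω, |Z ω| ^ r ∂μ) * (π / (2 * sin (π * (r / 2))))
      = Gamma (r + 1) * (1 / r * ∫ ω, X ω ^ (-r) ∂ν) := by
  set J := π / (2 * sin (π * (r / 2))) with hJ
  have hJ0 : 0 < J := by
    have : 0 < sin (π * (r / 2)) := by
      apply sin_pos_of_pos_of_lt_pi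
      · positivity
      · nlinarith [pi_pos]
    positivity
  have hG : 0 < Gamma (r + 1) := Gamma_pos_of_pos (by linarith)
  have hcore := core (g := fun x => 1 - φ x) (by fun_prop) (fun x hx => by linarith [h1 x hx])
    (fun x hx => by linarith [h0 x hx]) (q := r) (by linarith)
  have hnm := negmom ν hX hXpos hr0
  rw [setLIntegral_congr_fun (g := fun x => ENNReal.ofReal (1 - φ x) * ENNReal.ofReal (x ^ (-(r + 1))))
    measurableSet_Ioi (fun x hx => by
      have hx : 0 < x := hx
      simp only [hcdf x hx.le])] at hnm
  have hZside : ∫⁻ y in Ioi (0:ℝ),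
      ENNReal.ofReal (y ^ r * ∫ x in Ioi (0:ℝ), exp (-y * x) * (1 - φ x))
      = ∫⁻ ω, (∫⁻ y in Ioi (0:ℝ),
          ENNReal.ofReal (y ^ r * (1 / y - y / (y ^ 2 + Z ω ^ 2)))) ∂μ := by
    have hnn : ∀ y z : ℝ, 0 < y → 0 ≤ 1 / y - y / (y ^ 2 + z ^ 2) := by
      intro y z hy
      have : 1 / y - y / (y ^ 2 + z ^ 2) = z ^ 2 / (y * (y ^ 2 + z ^ 2)) := by
        field_simp; ring
      rw [this]; positivity
    rw [← core2 μ hZ (k := fun y z => y ^ r * (1 / y - y / (y ^ 2 + z ^ 2)))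
      (by unfold Function.uncurry; fun_prop) (fun y => y ^ r * (1 / y))
      (fun y z hy => mul_nonneg (by positivity) (hnn y z hy))
      (fun y z hy => by
        have : 0 ≤ y / (y ^ 2 + z ^ 2) := by positivity
        gcongr; linarith)]
    refine setLIntegral_congr_fun measurableSet_Ioi fun y hy => ?_
    have hy : 0 < y := hy
    have i1 := exp_neg_integrableOn_Ioi 0 hy
    have i2 : IntegrableOn (fun x => exp (-y * x) * φ x) (Ioi 0) := by
      refine Integrable.mono' i1 (by fun_prop) ?_
      refine (ae_restrict_mem measurableSet_Ioi).mono fun x hx => ?_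
      have hx : 0 < x := hx
      rw [norm_of_nonneg (mul_nonneg (exp_pos _).le (h0 x hx.le))]
      exact mul_le_of_le_one_right (exp_pos _).le (h1 x hx.le)
    simp only [mul_sub, mul_one]
    rw [integral_sub i1 i2, lap μ hZ hchar hy, integral_exp_mul_Ioi (by linarith) 0]
    simp only [← mul_sub]
    rw [integral_const_mul, integral_sub (integrable_const _)]
    · simp
    · refine Integrable.of_bound (C := y / y ^ 2)
        (Measurable.aestronglyMeasurable (by fun_prop)) (Eventually.of_forall fun ω => ?_)
      rw [norm_of_nonneg (by positivity)]
      gcongr; nlinarith [sq_nonneg (Z ω)]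
  rw [hZside, hnm] at hcore
  have hI : ∀ ω, ∫⁻ y in Ioi (0:ℝ), ENNReal.ofReal (y ^ r * (1 / y - y / (y ^ 2 + Z ω ^ 2)))
      = ENNReal.ofReal (|Z ω| ^ r) * ENNReal.ofReal J := by
    intro ω
    rcases eq_or_ne (Z ω) 0 with hz | hz
    · have : ∀ y : ℝ, 1 / y - y / y ^ 2 = 0 := by
        intro y
        rcases eq_or_ne y 0 with h | h
        · simp [h]
        · field_simp; simp
      simp [hz, zero_rpow hr0.ne', -one_div, this]
    have := lJ (a := r) hr0 (by linarith) hz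
    have hrr : |Z ω| ^ r = Z ω ^ 2 * |Z ω| ^ (r - 2) := by
      rw [← sq_abs, ← rpow_two, ← rpow_add (abs_pos.2 hz)]; ring_nf
    rw [← ENNReal.ofReal_mul (by positivity), hrr, mul_assoc, ENNReal.ofReal_mul (sq_nonneg _),
      ← this, ← lintegral_const_mul _ (by fun_prop)]
    refine setLIntegral_congr_fun measurableSet_Ioi fun y hy => ?_
    have hy : 0 < y := hy
    rw [← ENNReal.ofReal_mul (sq_nonneg _), rpow_sub_one hy.ne']
    congr 1
    field_simp
    ring
  simp_rw [hI] at hcore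
  rw [lintegral_mul_const _ (by fun_prop)] at hcore
  have key2 := congrArg ENNReal.toReal hcore
  have hr' : 0 ≤ 1 / r := by positivity
  simp only [ENNReal.toReal_mul, ENNReal.toReal_ofReal hr', ENNReal.toReal_ofReal hJ0.le,
    ENNReal.toReal_ofReal hG.le] at key2
  rwa [← integral_eq_lintegral_of_nonneg_ae (Eventually.of_forall fun ω => by positivity)
      (Measurable.aestronglyMeasurable (by fun_prop)), ← integral_eq_lintegral_of_nonneg_ae
      (Eventually.of_forall fun ω => (rpow_pos_of_pos (hXpos ω) _).le)
      (Measurable.aestronglyMeasurable (by fun_prop))] at key2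

end

theorem stmt8 {Ω Ω' : Type*} [MeasurableSpace Ω] [MeasurableSpace Ω']
    (μ : Measure Ω) (ν : Measure Ω') [IsProbabilityMeasure μ] [IsProbabilityMeasure ν]
    (φ : ℝ → ℝ) (hφeven : ∀ t, φ (-t) = φ t) (hφcont : Continuous φ) (hφ0 : φ 0 = 1)
    (hφanti : AntitoneOn φ (Ici (0 : ℝ))) (hφconv : ConvexOn ℝ (Ici (0 : ℝ)) φ)
    (hφlim : Tendsto φ atTop (nhds 0))
    (Z : Ω → ℝ) (hZ : Measurable Z)
    (hchar : ∀ t : ℝ, ∫ ω, Complex.exp (Complex.I * ((t * Z ω : ℝ) : ℂ)) ∂μ = (φ t : ℂ))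
    (X : Ω' → ℝ) (hX : Measurable X) (hXpos : ∀ ω, 0 < X ω)
    (hcdf : ∀ x : ℝ, 0 ≤ x → ν {ω | X ω ≤ x} = ENNReal.ofReal (1 - φ x))
    (hint : ∀ s ∈ Ioo (-1 : ℝ) 1, Integrable (fun ω => X ω ^ s) ν) :
    ∀ s : ℝ, |s| < 1 →
      ∫ ω, |Z ω| ^ (-s) ∂μ
        = (∫ ω, X ω ^ s ∂ν) / (Real.Gamma (s + 1) * Real.cos (s * π / 2)) := by
  have h0 : ∀ x, 0 ≤ x → 0 ≤ φ x := fun x hx =>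
    le_of_tendsto hφlim ((eventually_ge_atTop x).mono fun t ht => hφanti hx (hx.trans ht) ht)
  have h1 : ∀ x, 0 ≤ x → φ x ≤ 1 := fun x hx => hφ0 ▸ hφanti (le_refl (0:ℝ)) hx hx
  intro s hs
  obtain ⟨hs1, hs2⟩ := abs_lt.1 hs
  have hCpos : 0 < cos (s * π / 2) :=
    cos_pos_of_mem_Ioo ⟨by nlinarith [pi_pos], by nlinarith [pi_pos]⟩
  have hG1 : 0 < Gamma (s + 1) := Gamma_pos_of_pos (by linarith)
  rw [eq_div_iff (by positivity)]
  rcases lt_trichotomy s 0 with h | h | h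
  · have key := negcase μ ν hφcont h0 h1 hZ hchar hX hXpos hcdf (r := -s) (by linarith) (by linarith)
    rw [Gamma_add_one (by linarith), neg_neg] at key
    have href := Real.Gamma_mul_Gamma_one_sub (-s)
    have hS : 0 < sin (π * (-s / 2)) :=
      sin_pos_of_pos_of_lt_pi (by nlinarith [pi_pos]) (by nlinarith [pi_pos])
    have hC : cos (s * π / 2) = cos (π * (-s / 2)) := by
      rw [← cos_neg]; ring_nf
    rw [hC] at hCpos ⊢
    rw [show π * -s = 2 * (π * (-s / 2)) by ring, sin_two_mul, sub_neg_eq_add, add_comm 1 s] at href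
    have hG2 : 0 < Gamma (-s) := Gamma_pos_of_pos (by linarith)
    generalize Gamma (-s) = G at *
    generalize Gamma (s + 1) = G' at *
    generalize sin (π * (-s / 2)) = S at *
    generalize cos (π * (-s / 2)) = C at *
    generalize ∫ ω, |Z ω| ^ (-s) ∂μ = A at *
    generalize ∫ ω, X ω ^ s ∂ν = B at *
    have hpi := pi_pos
    have hsne : s ≠ 0 := h.ne
    have e : A * (π / (2 * S)) = G * B := by rw [key]; field_simp
    have : π / (2 * S) = G * G' * C := by rw [href]; field_simp
    rw [this] at e
    apply mul_left_cancel₀ hG2.ne'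
    linarith
  · subst h; simp
  · have key := poscase μ ν hφcont h0 h1 hZ hchar hX hXpos hcdf h hs2 (hint s ⟨hs1, hs2⟩)
    rw [Gamma_add_one h.ne'] at *
    have href := Real.Gamma_mul_Gamma_one_sub s
    have hS : 0 < sin (π * (s / 2)) :=
      sin_pos_of_pos_of_lt_pi (by nlinarith [pi_pos]) (by nlinarith [pi_pos])
    have hC : cos (s * π / 2) = cos (π * (s / 2)) := by ring_nf
    rw [hC] at hCpos ⊢
    rw [show π * s = 2 * (π * (s / 2)) by ring, sin_two_mul] at href
    rw [show π * ((2 - s) / 2) = π - π * (s / 2) by ring, sin_pi_sub] at key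
    have hG2 : 0 < Gamma (1 - s) := Gamma_pos_of_pos (by linarith)
    generalize Gamma (1 - s) = G at *
    generalize Gamma s = G' at *
    generalize sin (π * (s / 2)) = S at *
    generalize cos (π * (s / 2)) = C at *
    generalize ∫ ω, |Z ω| ^ (-s) ∂μ = A at *
    generalize ∫ ω, X ω ^ s ∂ν = B at *
    have hpi := pi_pos
    have : π / (2 * S) = G' * G * C := by rw [href]; field_simp
    rw [this] at key
    apply mul_left_cancel₀ hG2.ne'
    linarith
end

section
/- Let X ≥ 0 be a nonnegative random variable with mean m₁ = E[X] ∈ (0,∞). Let Z be a random variable with the length-biased distribution H(z) = m₁^{−1} ∫₀^z t dF(t), z ≥ 0, where F is the distribution of X, and let Y > 0 be a random variable with probability density function g(y) = (2/π)·(1 − E[cos(yX)])/(m₁ y²), y > 0. If E[X^s] < ∞ for some s ∈ (0,2), then E[Y^{1−s}] = E[X^s] / (m₁·Γ(s+1)·sin(sπ/2)) = E[Z^{s−1}] / (Γ(s+1)·sin(sπ/2)). -/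
open MeasureTheory Real Set Filter

lemma aux_gamma {a r : ℝ} (ha : 0 < a) (hr : 0 < r) :
    ∫⁻ t in Ioi (0:ℝ), ENNReal.ofReal (t ^ (a - 1) * rexp (-(r * t)))
      = ENNReal.ofReal ((1 / r) ^ a * Gamma a) := by
  have h := integral_rpow_mul_exp_neg_mul_Ioi ha hr
  rw [← h, ofReal_integral_eq_lintegral_ofReal]
  · have := integrableOn_rpow_mul_exp_neg_mul_rpow (p := 1) (s := a - 1) (b := r) (by linarith) one_pos hr
    refine this.congr_fun (fun t ht => ?_) measurableSet_Ioi
    simp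
  · exact (ae_restrict_iff' measurableSet_Ioi).2 (Eventually.of_forall fun t ht => by
      have : 0 < t := ht
      positivity)

lemma aux_gauss {s v : ℝ} (hs : 0 < s) (hv : 0 < v) :
    ∫⁻ t in Ioi (0:ℝ), ENNReal.ofReal (t ^ (s - 1) * rexp (-v * t ^ 2))
      = ENNReal.ofReal (v ^ (-(s / 2)) * (1 / 2) * Gamma (s / 2)) := by
  have h := integral_rpow_mul_exp_neg_mul_rpow (p := 2) (q := s - 1) (b := v) (by norm_num) (by linarith) hv
  have h2 := integrableOn_rpow_mul_exp_neg_mul_rpow (p := 2) (s := s - 1) (b := v) (by linarith) (by norm_num) hv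
  simp only [rpow_two] at h h2
  rw [show -(s/2) = -(s-1+1)/2 by ring, show s/2 = (s-1+1)/2 by ring, ← h, ofReal_integral_eq_lintegral_ofReal h2]
  exact (ae_restrict_iff' measurableSet_Ioi).2 (Eventually.of_forall fun t ht => by
      have : 0 < t := ht
      positivity)

lemma aux_exp {c : ℝ} (hc : 0 < c) :
    ∫⁻ v in Ioi (0:ℝ), ENNReal.ofReal (rexp (-(c * v))) = ENNReal.ofReal (1 / c) := by
  have := aux_gamma one_pos hc
  simpa using this

lemma aux_mellin {s x : ℝ} (hs : 0 < s) (hs2 : s < 2) (hx : 0 < x) :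
    ∫⁻ t in Ioi (0:ℝ), ENNReal.ofReal (t ^ (s - 1) * (1 / (x ^ 2 + t ^ 2)))
      = ENNReal.ofReal (x ^ (s - 2) * (π / (2 * sin (s * π / 2)))) := by
  have h1 : ∀ t ∈ Ioi (0:ℝ), ENNReal.ofReal (t ^ (s - 1) * (1 / (x ^ 2 + t ^ 2)))
      = ∫⁻ v in Ioi (0:ℝ), ENNReal.ofReal (t ^ (s - 1) * rexp (-((x ^ 2 + t ^ 2) * v))) := by
    intro t ht
    have ht : 0 < t := ht
    rw [ENNReal.ofReal_mul (by positivity), ← aux_exp (by positivity), ← lintegral_const_mul _ (by fun_prop)]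
    refine lintegral_congr fun v => ?_
    rw [ENNReal.ofReal_mul (by positivity)]
  rw [setLIntegral_congr_fun measurableSet_Ioi h1, lintegral_lintegral_swap (by
    apply Measurable.aemeasurable; unfold Function.uncurry; fun_prop)]
  have h2 : ∀ v ∈ Ioi (0:ℝ), ∫⁻ t in Ioi (0:ℝ), ENNReal.ofReal (t ^ (s - 1) * rexp (-((x ^ 2 + t ^ 2) * v)))
      = ENNReal.ofReal ((1 / 2) * Gamma (s / 2)) * ENNReal.ofReal (v ^ ((1 - s / 2) - 1) * rexp (-(x ^ 2 * v))) := by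
    intro v hv
    have hv : 0 < v := hv
    have hG : 0 < Gamma (s / 2) := Gamma_pos_of_pos (by linarith)
    rw [← ENNReal.ofReal_mul (by positivity), show (1 / 2) * Gamma (s / 2) * (v ^ ((1 - s / 2) - 1) * rexp (-(x ^ 2 * v)))
      = rexp (-(x ^ 2 * v)) * (v ^ (-(s / 2)) * (1 / 2) * Gamma (s / 2)) by
        rw [show (1 - s / 2) - 1 = -(s/2) by ring]; ring]
    rw [ENNReal.ofReal_mul (by positivity), ← aux_gauss hs hv, ← lintegral_const_mul _ (by fun_prop)]
    refine lintegral_congr fun t => ?_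
    rw [← ENNReal.ofReal_mul (by positivity)]
    congr 1
    rw [show -((x ^ 2 + t ^ 2) * v) = -(x ^ 2 * v) + -v * t ^ 2 by ring, exp_add]
    ring
  have hG : 0 < Gamma (s / 2) := Gamma_pos_of_pos (by linarith)
  rw [setLIntegral_congr_fun measurableSet_Ioi h2, lintegral_const_mul _ (by fun_prop),
    aux_gamma (by linarith) (by positivity), ← ENNReal.ofReal_mul (by positivity)]
  congr 1
  have hrefl := Real.Gamma_mul_Gamma_one_sub (s / 2)
  have e1 : (1 / x ^ 2) ^ (1 - s / 2) = x ^ (s - 2) := by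
    rw [one_div, ← rpow_natCast, ← rpow_neg hx.le, ← rpow_mul hx.le]
    congr 1; push_cast; ring
  rw [e1, show s * π / 2 = π * (s / 2) by ring]
  calc _ = x ^ (s - 2) * (1 / 2) * (Gamma (s / 2) * Gamma (1 - s / 2)) := by ring
    _ = _ := by rw [hrefl]; ring

lemma aux_laplace {x t : ℝ} (hx : 0 < x) (ht : 0 < t) :
    ∫⁻ u in Ioi (0:ℝ), ENNReal.ofReal ((1 - cos (u * x)) * rexp (-(u * t)))
      = ENNReal.ofReal (x ^ 2 / (t * (x ^ 2 + t ^ 2))) := by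
  have hne : x ^ 2 + t ^ 2 ≠ 0 := by positivity
  set G : ℝ → ℝ := fun u => rexp (-(u * t)) * (-1 / t - (x * sin (u * x) - t * cos (u * x)) / (x ^ 2 + t ^ 2)) with hG
  have hd : ∀ u, HasDerivAt G ((1 - cos (u * x)) * rexp (-(u * t))) u := by
    intro u
    have a1 : HasDerivAt (fun u : ℝ => u * x) x u := by simpa using (hasDerivAt_id u).mul_const x
    have a2 : HasDerivAt (fun u : ℝ => -(u * t)) (-t) u := by simpa using ((hasDerivAt_id u).mul_const t).fun_neg
    have := a2.exp.fun_mul (((a1.sin.const_mul x).fun_sub (a1.cos.const_mul t)).div_const (x ^ 2 + t ^ 2) |>.const_sub (-1 / t))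
    refine this.congr_deriv ?_
    field_simp
    ring
  have hnn : ∀ u ∈ Ioi (0:ℝ), 0 ≤ (1 - cos (u * x)) * rexp (-(u * t)) := fun u _ =>
    mul_nonneg (by linarith [cos_le_one (u * x)]) (exp_pos _).le
  have hlim : Tendsto G atTop (nhds 0) := by
    have b1 : Tendsto (fun u : ℝ => rexp (-(u * t))) atTop (nhds 0) :=
      tendsto_exp_neg_atTop_nhds_zero.comp (tendsto_id.atTop_mul_const ht)
    refine b1.zero_mul_isBoundedUnder_le ?_
    refine ⟨1 / t + (x + t) / (x ^ 2 + t ^ 2), ?_⟩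
    simp only [eventually_map]
    refine Eventually.of_forall fun u => ?_
    simp only [Function.comp, norm_eq_abs]
    refine (abs_sub _ _).trans ?_
    gcongr
    · rw [abs_div, abs_neg, abs_one, abs_of_pos ht]
    · rw [abs_div, abs_of_pos (by positivity : 0 < x ^ 2 + t ^ 2)]
      gcongr
      refine (abs_sub _ _).trans ?_
      rw [abs_mul, abs_mul, abs_of_pos hx, abs_of_pos ht]
      nlinarith [abs_sin_le_one (u * x), abs_cos_le_one (u * x)]
  have hi := integrableOn_Ioi_deriv_of_nonneg' (fun u _ => hd u) hnn hlim
  have hv := integral_Ioi_of_hasDerivAt_of_nonneg' (fun u _ => hd u) hnn hlim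
  rw [← ofReal_integral_eq_lintegral_ofReal hi ((ae_restrict_iff' measurableSet_Ioi).2 (Eventually.of_forall hnn)), hv]
  congr 1
  simp [hG]
  field_simp
  ring

lemma aux_cos {s x : ℝ} (hs : 0 < s) (hs2 : s < 2) (hx : 0 ≤ x) :
    ∫⁻ u in Ioi (0:ℝ), ENNReal.ofReal ((1 - cos (u * x)) * u ^ (-1 - s))
      = ENNReal.ofReal (x ^ s * (π / (2 * Gamma (s + 1) * sin (s * π / 2)))) := by
  rcases hx.eq_or_lt with rfl | hx
  · simp [zero_rpow hs.ne']
  have hG : 0 < Gamma (s + 1) := Gamma_pos_of_pos (by linarith)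
  have hc : ∀ u, 0 ≤ 1 - cos (u * x) := fun u => by linarith [cos_le_one (u * x)]
  have h1 : ∀ u ∈ Ioi (0:ℝ), ENNReal.ofReal ((1 - cos (u * x)) * u ^ (-1 - s))
      = ∫⁻ t in Ioi (0:ℝ), ENNReal.ofReal ((1 - cos (u * x)) / Gamma (s + 1) * (t ^ (s + 1 - 1) * rexp (-(u * t)))) := by
    intro u hu
    have hu : 0 < u := hu
    have hcu := hc u
    simp_rw [ENNReal.ofReal_mul (div_nonneg hcu hG.le)]
    rw [lintegral_const_mul _ (by fun_prop), aux_gamma (by linarith) hu, ← ENNReal.ofReal_mul (by positivity)]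
    congr 1
    rw [one_div, inv_rpow hu.le, ← rpow_neg hu.le, show -(s + 1) = -1 - s by ring]
    field_simp
  rw [setLIntegral_congr_fun measurableSet_Ioi h1, lintegral_lintegral_swap (by
    apply Measurable.aemeasurable; unfold Function.uncurry; fun_prop)]
  have h2 : ∀ t ∈ Ioi (0:ℝ), ∫⁻ u in Ioi (0:ℝ), ENNReal.ofReal ((1 - cos (u * x)) / Gamma (s + 1) * (t ^ (s + 1 - 1) * rexp (-(u * t))))
      = ENNReal.ofReal (x ^ 2 / Gamma (s + 1)) * ENNReal.ofReal (t ^ (s - 1) * (1 / (x ^ 2 + t ^ 2))) := by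
    intro t ht
    have ht : 0 < t := ht
    have e : ∀ u, (1 - cos (u * x)) / Gamma (s + 1) * (t ^ (s + 1 - 1) * rexp (-(u * t)))
       = (t ^ (s + 1 - 1) / Gamma (s + 1)) * ((1 - cos (u * x)) * rexp (-(u * t))) := fun u => by ring
    have hp : 0 ≤ t ^ (s + 1 - 1) / Gamma (s + 1) := by positivity
    simp_rw [e, ENNReal.ofReal_mul hp]
    rw [lintegral_const_mul _ (by fun_prop), aux_laplace hx ht, ← ENNReal.ofReal_mul (by positivity), ← ENNReal.ofReal_mul (by positivity)]
    congr 1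
    rw [show s + 1 - 1 = s - 1 + 1 by ring, rpow_add_one ht.ne']
    field_simp
  rw [setLIntegral_congr_fun measurableSet_Ioi h2, lintegral_const_mul _ (by fun_prop),
    aux_mellin hs hs2 hx, ← ENNReal.ofReal_mul (by positivity)]
  congr 1
  have : x ^ s = x ^ (s - 2) * x ^ 2 := by
    rw [← rpow_natCast x 2, ← rpow_add hx]; congr 1; push_cast; ring
  rw [this]
  have : sin (s * π / 2) ≠ 0 := (sin_pos_of_pos_of_lt_pi (by positivity) (by nlinarith [pi_pos])).ne'
  field_simp

theorem stmt9 {Ω Ω₁ Ω₂ : Type*} [MeasurableSpace Ω] [MeasurableSpace Ω₁] [MeasurableSpace Ω₂]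
    (μ : Measure Ω) (ν₁ : Measure Ω₁) (ν₂ : Measure Ω₂)
    [IsProbabilityMeasure μ] [IsProbabilityMeasure ν₁] [IsProbabilityMeasure ν₂]
    (X : Ω → ℝ) (hX : Measurable X) (hXnn : ∀ ω, 0 ≤ X ω)
    (hm : Integrable X μ) (hmpos : 0 < ∫ ω, X ω ∂μ)
    -- Z has the length-biased distribution `dH(t) = (t/m₁) dF(t)`
    (Z : Ω₂ → ℝ) (hZ : Measurable Z)
    (hZdist : Measure.map Z ν₂
      = (Measure.map X μ).withDensity (fun t => ENNReal.ofReal (t / ∫ ω, X ω ∂μ)))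
    -- Y has density `g(y) = (2/π) (1 - E[cos(yX)]) / (m₁ y²)` on `(0,∞)`
    (Y : Ω₁ → ℝ) (hY : Measurable Y) (hYpos : ∀ ω, 0 < Y ω)
    (hYdist : Measure.map Y ν₁
      = volume.withDensity
          (fun y => ENNReal.ofReal
            (if 0 < y then
              2 / π * (1 - ∫ ω, Real.cos (y * X ω) ∂μ) / ((∫ ω, X ω ∂μ) * y ^ 2)
            else 0)))
    (s : ℝ) (hs1 : 0 < s) (hs2 : s < 2)
    (hint : Integrable (fun ω => X ω ^ s) μ) :
    (∫ ω, Y ω ^ (1 - s) ∂ν₁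
        = (∫ ω, X ω ^ s ∂μ) / ((∫ ω, X ω ∂μ) * Real.Gamma (s + 1) * Real.sin (s * π / 2)))
      ∧ ∫ ω, Y ω ^ (1 - s) ∂ν₁
          = (∫ ω, Z ω ^ (s - 1) ∂ν₂) / (Real.Gamma (s + 1) * Real.sin (s * π / 2)) := by
  set m := ∫ ω, X ω ∂μ with hm_def
  have hG : 0 < Gamma (s + 1) := Gamma_pos_of_pos (by linarith)
  have hS : 0 < sin (s * π / 2) := sin_pos_of_pos_of_lt_pi (by positivity) (by nlinarith [pi_pos])
  have hcm : Measurable fun y : ℝ => ∫ ω, Real.cos (y * X ω) ∂μ := by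
    have : StronglyMeasurable (Function.uncurry fun (y : ℝ) ω => Real.cos (y * X ω)) := by
      apply Measurable.stronglyMeasurable; unfold Function.uncurry; fun_prop
    exact this.integral_prod_right.measurable
  have hci : ∀ y : ℝ, Integrable (fun ω => Real.cos (y * X ω)) μ := fun y =>
    Integrable.of_bound (by apply Measurable.aestronglyMeasurable; fun_prop) 1
      (Eventually.of_forall fun ω => abs_cos_le_one _)
  have hXs : 0 ≤ ∫ ω, X ω ^ s ∂μ := integral_nonneg fun ω => rpow_nonneg (hXnn ω) _
  have hA : ∫ ω, Y ω ^ (1 - s) ∂ν₁ = (∫ ω, X ω ^ s ∂μ) / (m * Gamma (s + 1) * sin (s * π / 2)) := by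
    rw [integral_eq_lintegral_of_nonneg_ae
      (Eventually.of_forall fun ω => rpow_nonneg (hYpos ω).le _)
      (by apply Measurable.aestronglyMeasurable; fun_prop),
      ← lintegral_map (f := fun y : ℝ => ENNReal.ofReal (y ^ (1 - s))) (by fun_prop) hY, hYdist,
      lintegral_withDensity_eq_lintegral_mul _ (by
        apply Measurable.ennreal_ofReal
        refine Measurable.ite measurableSet_Ioi ?_ measurable_const
        fun_prop) (by fun_prop)]
    have h1 : ∀ y : ℝ, ((fun y => ENNReal.ofReal
            (if 0 < y then
              2 / π * (1 - ∫ ω, Real.cos (y * X ω) ∂μ) / (m * y ^ 2)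
            else 0)) * fun y : ℝ => ENNReal.ofReal (y ^ (1 - s))) y =
        (Ioi (0:ℝ)).indicator (fun y => ENNReal.ofReal (2 / (π * m)) *
          ∫⁻ ω, ENNReal.ofReal ((1 - Real.cos (y * X ω)) * y ^ (-1 - s)) ∂μ) y := by
      intro y
      by_cases hy : 0 < y
      · have hnn : ∀ ω, 0 ≤ (1 - Real.cos (y * X ω)) * y ^ (-1 - s) := fun ω =>
          mul_nonneg (by linarith [cos_le_one (y * X ω)]) (by positivity)
        rw [indicator_of_mem (show y ∈ Ioi (0:ℝ) from hy),
          ← ofReal_integral_eq_lintegral_ofReal (f := fun ω => (1 - Real.cos (y * X ω)) * y ^ (-1 - s))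
            (((integrable_const 1).sub (hci y)).mul_const _)
            (Eventually.of_forall hnn), ← ENNReal.ofReal_mul (by positivity)]
        simp only [Pi.mul_apply, if_pos hy]
        rw [← ENNReal.ofReal_mul' (by positivity), integral_mul_const,
          integral_sub (integrable_const 1) (hci y)]
        congr 1
        have : y ^ (1 - s) = y ^ (-1 - s) * y ^ 2 := by
          rw [← rpow_natCast y 2, ← rpow_add hy]; congr 1; push_cast; ring
        rw [this]
        simp
        field_simp
      · simp [hy]
    rw [lintegral_congr h1, lintegral_indicator measurableSet_Ioi, lintegral_const_mul' _ _ ENNReal.ofReal_ne_top,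
      lintegral_lintegral_swap (by
        apply Measurable.aemeasurable; unfold Function.uncurry; fun_prop)]
    simp_rw [fun ω => aux_cos hs1 hs2 (hXnn ω)]
    rw [← ofReal_integral_eq_lintegral_ofReal (hint.mul_const _)
      (Eventually.of_forall fun ω => mul_nonneg (rpow_nonneg (hXnn ω) _) (by positivity)),
      integral_mul_const, ← ENNReal.ofReal_mul (by positivity), ENNReal.toReal_ofReal (by positivity)]
    field_simp
  have hZnn : ∀ᵐ ω ∂ν₂, 0 ≤ Z ω := by
    have : ∀ᵐ z ∂(Measure.map Z ν₂), 0 ≤ z := by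
      rw [hZdist]
      refine (withDensity_absolutelyContinuous _ _).ae_le ?_
      exact (ae_map_iff hX.aemeasurable measurableSet_Ici).2 (Eventually.of_forall hXnn)
    exact ae_of_ae_map hZ.aemeasurable this
  have hB : ∫ ω, Z ω ^ (s - 1) ∂ν₂ = (∫ ω, X ω ^ s ∂μ) / m := by
    rw [integral_eq_lintegral_of_nonneg_ae
      (hZnn.mono fun ω h => rpow_nonneg h _)
      (by apply Measurable.aestronglyMeasurable; fun_prop),
      ← lintegral_map (f := fun y : ℝ => ENNReal.ofReal (y ^ (s - 1))) (by fun_prop) hZ, hZdist,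
      lintegral_withDensity_eq_lintegral_mul _ (by fun_prop) (by fun_prop),
      lintegral_map (by fun_prop) hX]
    have h1 : ∀ ω, ((fun t => ENNReal.ofReal (t / m)) * fun y : ℝ => ENNReal.ofReal (y ^ (s - 1))) (X ω)
        = ENNReal.ofReal (X ω ^ s / m) := by
      intro ω
      have h0 := hXnn ω
      simp only [Pi.mul_apply]
      rw [← ENNReal.ofReal_mul (by positivity)]
      congr 1
      rcases h0.eq_or_lt with h | h
      · simp [← h, zero_rpow hs1.ne']
      · rw [rpow_sub_one h.ne']; field_simp
    rw [lintegral_congr h1, ← ofReal_integral_eq_lintegral_ofReal (hint.div_const _)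
      (Eventually.of_forall fun ω => div_nonneg (rpow_nonneg (hXnn ω) _) hmpos.le), integral_div,
      ENNReal.toReal_ofReal (by positivity)]
  refine ⟨hA, ?_⟩
  rw [hA, hB, div_div, mul_assoc]
end

section
/- Let X and Y be nonnegative random variables with E[X^s] = E[Y^s] ∈ (0,∞) for some s ∈ (0,1), and let {a_k}_{k=1}^∞ be a sequence of positive, pairwise distinct real numbers satisfying one of the following conditions: (a) lim_{k→∞} a_k = ∞ and Σ_{k=1}^∞ 1/a_k = ∞; (b) lim_{k→∞} a_k = a₀ ∈ (0,∞); (c) lim_{k→∞} a_k = 0 and Σ_{k=1}^∞ a_k = ∞. If E[(X+a_k)^s] = E[(Y+a_k)^s] for all k ≥ 1, then X and Y have the same distribution. -/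
open MeasureTheory Real Set Filter

/-- One-zero Schwarz estimate in the right half plane. -/
lemma schwarz_half {f : ℂ → ℂ} {M : ℝ} (hf : DifferentiableOn ℂ f {z | 0 < z.re})
    (hM : ∀ z : ℂ, 0 < z.re → ‖f z‖ ≤ M) {a : ℝ} (ha : 0 < a) (hfa : f a = 0)
    {z : ℂ} (hz : 0 < z.re) : ‖f z‖ ≤ M * ‖(z - a) / (z + a)‖ := by
  have hφ : ∀ u : ℂ, ‖u‖ < 1 → 1 - u ≠ 0 ∧ 0 < ((a : ℂ) * (1 + u) / (1 - u)).re := by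
    intro u hu
    have h1 : 1 - u ≠ 0 := by
      intro h
      have : u = 1 := by linear_combination -h
      rw [this] at hu; simp at hu
    refine ⟨h1, ?_⟩
    have h2 : 0 < Complex.normSq (1 - u) := Complex.normSq_pos.2 h1
    have h3 : Complex.normSq u < 1 := by
      rw [Complex.normSq_eq_norm_sq]; nlinarith [norm_nonneg u]
    rw [mul_div_assoc, Complex.re_ofReal_mul, Complex.div_re]
    apply mul_pos ha
    rw [← add_div]
    apply div_pos _ h2
    simp [Complex.normSq_apply] at *
    nlinarith
  have hza : z + a ≠ 0 := by
    intro h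
    have := congrArg Complex.re h
    simp at this; linarith
  set u := (z - a) / (z + a) with hu
  have hu1 : ‖u‖ < 1 := by
    rw [hu, norm_div, div_lt_one (norm_pos_iff.2 hza)]
    apply lt_of_pow_lt_pow_left₀ 2 (norm_nonneg _)
    rw [← Complex.normSq_eq_norm_sq, ← Complex.normSq_eq_norm_sq]
    simp [Complex.normSq_apply]
    nlinarith
  have hac : (a : ℂ) ≠ 0 := by exact_mod_cast ha.ne'
  have hzu : (a : ℂ) * (1 + u) / (1 - u) = z := by
    rw [div_eq_iff (hφ u hu1).1, hu]
    field_simp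
    ring
  have key := Complex.dist_le_div_mul_dist_of_mapsTo_ball (c := 0) (R₁ := 1) (R₂ := M)
    (f := fun u => f ((a : ℂ) * (1 + u) / (1 - u))) (z := u) ?_ ?_ (by simpa using hu1)
  · simpa [hfa, hzu] using key
  · refine DifferentiableOn.comp hf ?_ ?_
    · intro v hv
      have := (hφ v (by simpa using hv)).1
      apply DifferentiableAt.differentiableWithinAt
      fun_prop (disch := assumption)
    · intro v hv
      exact (hφ v (by simpa using hv)).2
  · intro v hv
    have := hM _ (hφ v (by simpa using hv)).2
    simpa [hfa] using this

lemma blaschke (S : Finset ℝ) : ∀ (f : ℂ → ℂ) (M : ℝ) (_ : DifferentiableOn ℂ f {z | 0 < z.re})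
    (_ : ∀ z : ℂ, 0 < z.re → ‖f z‖ ≤ M) (_ : ∀ a ∈ S, 0 < a) (_ : ∀ a ∈ S, f a = 0)
    (z : ℂ) (_ : 0 < z.re), ‖f z‖ ≤ M * ∏ a ∈ S, ‖(z - a) / (z + a)‖ := by
  classical
  induction S using Finset.induction_on with
  | empty => intro f M hf hM _ _ z hz; simpa using hM z hz
  | insert a S haS ih =>
    intro f M hf hM hpos hzero z hz
    have ha : 0 < a := hpos a (by simp)
    have hfa : f a = 0 := hzero a (by simp)
    have hopen : IsOpen {z : ℂ | 0 < z.re} := isOpen_lt continuous_const Complex.continuous_re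
    have hnh : {z : ℂ | 0 < z.re} ∈ nhds (a : ℂ) := hopen.mem_nhds (by simpa using ha)
    set g : ℂ → ℂ := fun z => dslope f a z * (z + a) with hg
    have hgd : DifferentiableOn ℂ g {z | 0 < z.re} :=
      ((Complex.differentiableOn_dslope hnh).2 hf).mul (by fun_prop)
    have hgne : ∀ w : ℂ, w ≠ a → g w = f w * ((w + a) / (w - a)) := by
      intro w hw
      have : w - a ≠ 0 := sub_ne_zero.2 hw
      simp only [hg, dslope_of_ne _ hw, slope_def_field, hfa]
      field_simp
      simp
    have hadd : ∀ w : ℂ, 0 < w.re → w + a ≠ 0 := by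
      intro w hw h
      have := congrArg Complex.re h
      simp at this; linarith
    have hgM' : ∀ w : ℂ, 0 < w.re → w ≠ a → ‖g w‖ ≤ M := by
      intro w hw hwa
      rw [hgne w hwa, norm_mul]
      have h1 := schwarz_half hf hM ha hfa hw
      have h2 : 0 < ‖w - a‖ := norm_pos_iff.2 (sub_ne_zero.2 hwa)
      have h3 : 0 < ‖w + a‖ := norm_pos_iff.2 (hadd w hw)
      calc _ ≤ M * ‖(w - a) / (w + a)‖ * ‖(w + a) / (w - a)‖ := by gcongr
        _ = M := by rw [norm_div, norm_div]; field_simp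
    have hgM : ∀ w : ℂ, 0 < w.re → ‖g w‖ ≤ M := by
      intro w hw
      by_cases hwa : w = a
      · subst hwa
        have hc : ContinuousAt g a := (hgd.differentiableAt hnh).continuousAt
        have ht : Tendsto (fun w => ‖g w‖) (nhdsWithin (a : ℂ) {(a : ℂ)}ᶜ) (nhds ‖g a‖) :=
          (hc.norm.tendsto).mono_left nhdsWithin_le_nhds
        refine le_of_tendsto ht ?_
        filter_upwards [self_mem_nhdsWithin, mem_nhdsWithin_of_mem_nhds hnh] with v hv1 hv2
        exact hgM' v hv2 hv1
      · exact hgM' w hw hwa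
    have h := ih g M hgd hgM (fun b hb => hpos b (by simp [hb])) (by
      intro b hb
      have : (b : ℂ) ≠ a := by
        intro h; apply haS; rw [Complex.ofReal_inj] at h; rwa [← h]
      rw [hgne _ this, hzero b (by simp [hb])]; simp) z hz
    rw [Finset.prod_insert haS]
    have hfz : f z = g z * ((z - a) / (z + a)) := by
      by_cases hza : z = a
      · rw [hza, hfa]; simp
      · rw [hgne z hza]
        have : z - a ≠ 0 := sub_ne_zero.2 hza
        have := hadd z hz
        field_simp
    rw [hfz, norm_mul]
    calc _ ≤ (M * ∏ a ∈ S, ‖(z - a) / (z + a)‖) * ‖(z - a) / (z + a)‖ := by gcongr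
      _ = _ := by ring

lemma not_summable_min {a : ℕ → ℝ} (ha_pos : ∀ k, 0 < a k)
    (ha_cond :
      (Tendsto a atTop atTop ∧ ¬ Summable (fun k => 1 / a k))
        ∨ (∃ a₀ : ℝ, 0 < a₀ ∧ Tendsto a atTop (nhds a₀))
        ∨ (Tendsto a atTop (nhds 0) ∧ ¬ Summable a)) {x : ℝ} (hx : 0 < x) :
    ¬ Summable (fun k => min x (a k) / (x + a k)) := by
  intro hs
  rcases ha_cond with ⟨h1, h2⟩ | ⟨a₀, h0, h1⟩ | ⟨h1, h2⟩
  · apply h2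
    refine summable_of_isBigO_nat (hs.mul_left (2 / x)) ?_
    apply Asymptotics.IsBigO.of_bound 1
    filter_upwards [h1.eventually_ge_atTop x] with k hk
    have := ha_pos k
    rw [min_eq_left hk, norm_of_nonneg (by positivity), norm_of_nonneg (by positivity)]
    rw [one_mul, div_mul_div_comm, div_le_div_iff₀ (by positivity) (by positivity)]
    nlinarith
  · have ht : Tendsto (fun k => min x (a k) / (x + a k)) atTop (nhds (min x a₀ / (x + a₀))) := by
      apply Tendsto.div
      · exact tendsto_const_nhds.min h1
      · exact tendsto_const_nhds.add h1
      · positivity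
    have := tendsto_nhds_unique ht hs.tendsto_atTop_zero
    have h3 : 0 < min x a₀ / (x + a₀) := by
      have := lt_min hx h0
      positivity
    linarith
  · apply h2
    refine summable_of_isBigO_nat (hs.mul_left (2 * x)) ?_
    apply Asymptotics.IsBigO.of_bound 1
    filter_upwards [h1.eventually_le_const hx] with k hk
    have := ha_pos k
    rw [min_eq_right hk, norm_of_nonneg (by positivity), norm_of_nonneg (by positivity)]
    rw [one_mul, ← mul_div_assoc, le_div_iff₀ (by positivity)]
    nlinarith

lemma factor_le {x a : ℝ} (hx : 0 < x) (ha : 0 < a) :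
    ‖((x : ℂ) - a) / (x + a)‖ ≤ exp (-(2 * (min x a / (x + a)))) := by
  have h : ‖((x : ℂ) - a) / (x + a)‖ = |(x - a) / (x + a)| := by
    rw [← Complex.ofReal_sub, ← Complex.ofReal_add, ← Complex.ofReal_div, Complex.norm_real]; rfl
  rw [h]
  have h1 := Real.add_one_le_exp (-(2 * (min x a / (x + a))))
  refine le_trans ?_ h1
  rw [abs_div, abs_of_pos (show 0 < x + a by positivity)]
  have h2 : -(2 * (min x a / (x + a))) + 1 = (x + a - 2 * min x a) / (x + a) := by
    field_simp; ring
  rw [h2]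
  gcongr
  rcases le_total x a with h | h
  · rw [min_eq_left h, abs_of_nonpos (by linarith)]; linarith
  · rw [min_eq_right h, abs_of_nonneg (by linarith)]; linarith

lemma zero_of_zeros {f : ℂ → ℂ} {M : ℝ} (hf : DifferentiableOn ℂ f {z | 0 < z.re})
    (hM : ∀ z : ℂ, 0 < z.re → ‖f z‖ ≤ M) {a : ℕ → ℝ} (ha_pos : ∀ k, 0 < a k)
    (ha_inj : Function.Injective a)
    (ha_cond :
      (Tendsto a atTop atTop ∧ ¬ Summable (fun k => 1 / a k))
        ∨ (∃ a₀ : ℝ, 0 < a₀ ∧ Tendsto a atTop (nhds a₀))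
        ∨ (Tendsto a atTop (nhds 0) ∧ ¬ Summable a))
    (hz : ∀ k, f (a k) = 0) {x : ℝ} (hx : 0 < x) : f x = 0 := by
  classical
  have hns := not_summable_min ha_pos ha_cond hx
  have hnn : ∀ k, 0 ≤ min x (a k) / (x + a k) := by
    intro k
    have := ha_pos k
    have := lt_min hx this
    positivity
  rw [not_summable_iff_tendsto_nat_atTop_of_nonneg hnn] at hns
  have hM0 : 0 ≤ M := (norm_nonneg _).trans (hM x (by simpa using hx))
  have hb : ∀ n : ℕ, ‖f x‖ ≤
      M * exp (-(2 * ∑ k ∈ Finset.range n, min x (a k) / (x + a k))) := by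
    intro n
    have h := blaschke ((Finset.range n).image a) f M hf hM
      (by intro b hb; obtain ⟨k, -, rfl⟩ := Finset.mem_image.1 hb; exact ha_pos k)
      (by intro b hb; obtain ⟨k, -, rfl⟩ := Finset.mem_image.1 hb; exact hz k) x (by simpa using hx)
    rw [Finset.prod_image (fun i _ j _ h => ha_inj h)] at h
    refine h.trans ?_
    rw [Finset.mul_sum, ← Finset.sum_neg_distrib, Real.exp_sum]
    gcongr with k hk
    exact factor_le hx (ha_pos k)
  have ht : Tendsto (fun n : ℕ => M * exp (-(2 * ∑ k ∈ Finset.range n, min x (a k) / (x + a k))))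
      atTop (nhds (M * 0)) :=
    (tendsto_exp_neg_atTop_nhds_zero.comp (hns.const_mul_atTop (by norm_num : (0:ℝ) < 2))).const_mul M
  have := ge_of_tendsto' ht hb
  rw [mul_zero] at this
  exact norm_le_zero_iff.1 this

lemma add_ne_aux {x : ℝ} (hx : 0 ≤ x) {z : ℂ} (hz : 0 < z.re) :
    (x : ℂ) + z ∈ Complex.slitPlane ∧ ‖z‖ ≤ ‖(x : ℂ) + z‖ := by
  refine ⟨Or.inl (by simp; linarith), ?_⟩
  apply le_of_sq_le_sq _ (norm_nonneg _)
  rw [← Complex.normSq_eq_norm_sq, ← Complex.normSq_eq_norm_sq]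
  simp [Complex.normSq_apply]
  nlinarith [mul_nonneg hx hz.le]

lemma deriv_aux {x : ℝ} (hx : 0 ≤ x) {z : ℂ} (hz : 0 < z.re) (s : ℝ) :
    HasDerivAt (fun z : ℂ => ((x : ℂ) + z) ^ (s : ℂ)) (s * ((x : ℂ) + z) ^ ((s - 1 : ℝ) : ℂ)) z := by
  have h := ((hasDerivAt_id z).const_add (x : ℂ)).cpow_const (c := (s : ℂ)) (add_ne_aux hx hz).1
  simpa using h

lemma cpow_bound {s : ℝ} (hs1 : 0 < s) (hs2 : s < 1) {x : ℝ} (hx : 0 ≤ x) {z : ℂ}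
    (hz : 0 < z.re) : ‖((x : ℂ) + z) ^ (s : ℂ) - z ^ (s : ℂ)‖ ≤ 3 * x ^ s := by
  have hz0 : 0 < ‖z‖ := norm_pos_iff.2 (by rintro rfl; simp at hz)
  rcases le_total ‖z‖ x with h | h
  · refine (norm_sub_le _ _).trans ?_
    rw [Complex.norm_cpow_real, Complex.norm_cpow_real]
    have h1 : ‖(x : ℂ) + z‖ ≤ 2 * x := by
      refine (norm_add_le _ _).trans ?_
      rw [Complex.norm_real, norm_of_nonneg hx]; linarith
    have h2 : ‖(x : ℂ) + z‖ ^ s ≤ 2 * x ^ s := by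
      calc _ ≤ (2 * x) ^ s := by gcongr
        _ = 2 ^ s * x ^ s := by rw [mul_rpow (by norm_num) hx]
        _ ≤ 2 ^ (1 : ℝ) * x ^ s := by gcongr; norm_num
        _ = _ := by norm_num
    have h3 : ‖z‖ ^ s ≤ x ^ s := by gcongr
    linarith
  · rcases hx.eq_or_lt with rfl | hx0
    · simp [Real.zero_rpow hs1.ne']
    have key := norm_image_sub_le_of_norm_deriv_le_segment' (a := 0) (b := x)
      (f := fun t : ℝ => ((t : ℂ) + z) ^ (s : ℂ))
      (f' := fun t : ℝ => s * ((t : ℂ) + z) ^ ((s - 1 : ℝ) : ℂ)) (C := x ^ (s - 1)) ?_ ?_ x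
      (right_mem_Icc.2 hx)
    · have e : x ^ (s - 1) * x = x ^ s := by
        rw [rpow_sub_one hx0.ne']; field_simp
      simp only [sub_zero, e, Complex.ofReal_zero, zero_add] at key
      have : 0 ≤ x ^ s := by positivity
      linarith
    · intro t ht
      have h1 := ((hasDerivAt_id (t : ℂ)).add_const z).cpow_const (c := (s : ℂ))
        (add_ne_aux ht.1 hz).1
      have h2 := h1.comp_ofReal
      simpa using h2.hasDerivWithinAt
    · intro t ht
      rw [norm_mul, Complex.norm_cpow_real, Complex.norm_real, norm_of_nonneg hs1.le]
      have h1 := (add_ne_aux ht.1 hz).2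
      calc _ ≤ 1 * ‖(t : ℂ) + z‖ ^ (s - 1) := by gcongr
        _ ≤ x ^ (s - 1) := by
          rw [one_mul]
          exact rpow_le_rpow_of_nonpos hx0 (h.trans h1) (by linarith)

set_option linter.unusedSectionVars false

section
variable {Ω : Type*} [MeasurableSpace Ω] {μ : Measure Ω} [IsProbabilityMeasure μ] {X : Ω → ℝ}

lemma meas_aux (hX : Measurable X) (s : ℝ) (z : ℂ) :
    AEStronglyMeasurable (fun ω => ((X ω : ℂ) + z) ^ (s : ℂ) - z ^ (s : ℂ)) μ := by
  apply Measurable.aestronglyMeasurable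
  fun_prop

lemma int_aux (hX : Measurable X) (hXnn : ∀ ω, 0 ≤ X ω) {s : ℝ} (hs1 : 0 < s) (hs2 : s < 1)
    (hint : Integrable (fun ω => X ω ^ s) μ) {z : ℂ} (hz : 0 < z.re) :
    Integrable (fun ω => ((X ω : ℂ) + z) ^ (s : ℂ) - z ^ (s : ℂ)) μ :=
  (hint.const_mul 3).mono' (meas_aux hX s z)
    (Eventually.of_forall fun ω => cpow_bound hs1 hs2 (hXnn ω) hz)

lemma diff_aux (hX : Measurable X) (hXnn : ∀ ω, 0 ≤ X ω) {s : ℝ} (hs1 : 0 < s) (hs2 : s < 1)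
    (hint : Integrable (fun ω => X ω ^ s) μ) :
    DifferentiableOn ℂ (fun z : ℂ => ∫ ω, (((X ω : ℂ) + z) ^ (s : ℂ) - z ^ (s : ℂ)) ∂μ)
      {z | 0 < z.re} := by
  intro z₀ hz₀
  have hz₀ : 0 < z₀.re := hz₀
  have hnh : {z : ℂ | z₀.re / 2 < z.re} ∈ nhds z₀ :=
    (isOpen_lt continuous_const Complex.continuous_re).mem_nhds (by simp; linarith)
  have h := hasDerivAt_integral_of_dominated_loc_of_deriv_le (μ := μ) (𝕜 := ℂ)
    (F := fun z ω => ((X ω : ℂ) + z) ^ (s : ℂ) - z ^ (s : ℂ))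
    (F' := fun z ω => s * ((X ω : ℂ) + z) ^ ((s - 1 : ℝ) : ℂ) - s * z ^ ((s - 1 : ℝ) : ℂ))
    (bound := fun _ => 2 * (z₀.re / 2) ^ (s - 1)) hnh
    (Eventually.of_forall fun z => meas_aux hX s z) (int_aux hX hXnn hs1 hs2 hint hz₀)
    (by apply Measurable.aestronglyMeasurable; fun_prop) ?_ (integrable_const _) ?_
  · exact h.2.differentiableAt.differentiableWithinAt
  · refine Eventually.of_forall fun ω z hz => ?_
    have hz : z₀.re / 2 < z.re := hz
    have hzp : 0 < z.re := by linarith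
    have h1 : z₀.re / 2 ≤ ‖z‖ := hz.le.trans (Complex.re_le_norm z)
    have h2 := h1.trans (add_ne_aux (hXnn ω) hzp).2
    have hb : ∀ w : ℂ, z₀.re / 2 ≤ ‖w‖ → ‖s * w ^ ((s - 1 : ℝ) : ℂ)‖ ≤ (z₀.re / 2) ^ (s - 1) := by
      intro w hw
      rw [norm_mul, Complex.norm_cpow_real, Complex.norm_real, norm_of_nonneg hs1.le]
      calc _ ≤ 1 * ‖w‖ ^ (s - 1) := by gcongr
        _ ≤ _ := by
          rw [one_mul]
          exact rpow_le_rpow_of_nonpos (by linarith) hw (by linarith)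
    refine (norm_sub_le _ _).trans ?_
    linarith [hb _ h1, hb _ h2]
  · refine Eventually.of_forall fun ω z hz => ?_
    have hz : z₀.re / 2 < z.re := hz
    have hzp : 0 < z.re := by linarith
    have := deriv_aux le_rfl hzp s
    simp only [Complex.ofReal_zero, zero_add] at this
    exact (deriv_aux (hXnn ω) hzp s).sub this

lemma bound_aux (hXnn : ∀ ω, 0 ≤ X ω) {s : ℝ} (hs1 : 0 < s) (hs2 : s < 1)
    (hint : Integrable (fun ω => X ω ^ s) μ) {z : ℂ} (hz : 0 < z.re) :
    ‖∫ ω, (((X ω : ℂ) + z) ^ (s : ℂ) - z ^ (s : ℂ)) ∂μ‖ ≤ ∫ ω, 3 * X ω ^ s ∂μ :=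
  norm_integral_le_of_norm_le (hint.const_mul 3)
    (Eventually.of_forall fun ω => cpow_bound hs1 hs2 (hXnn ω) hz)

lemma rint_aux (hX : Measurable X) (hXnn : ∀ ω, 0 ≤ X ω) {s : ℝ} (hs1 : 0 < s) (hs2 : s < 1)
    (hint : Integrable (fun ω => X ω ^ s) μ) {x : ℝ} (hx : 0 < x) :
    Integrable (fun ω => (X ω + x) ^ s) μ ∧
    ∫ ω, (((X ω : ℂ) + x) ^ (s : ℂ) - (x : ℂ) ^ (s : ℂ)) ∂μ
      = ((∫ ω, (X ω + x) ^ s ∂μ - x ^ s : ℝ) : ℂ) := by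
  have h1 : Integrable (fun ω => (X ω + x) ^ s) μ := by
    refine (hint.add (integrable_const (x ^ s))).mono'
      (Measurable.aestronglyMeasurable (by fun_prop)) (Eventually.of_forall fun ω => ?_)
    have := hXnn ω
    rw [norm_of_nonneg (by positivity)]
    exact rpow_add_le_add_rpow (hXnn ω) hx.le hs1.le hs2.le
  refine ⟨h1, ?_⟩
  have h2 : ∫ ω, (X ω + x) ^ s ∂μ - x ^ s = ∫ ω, ((X ω + x) ^ s - x ^ s) ∂μ := by
    rw [integral_sub h1 (integrable_const _)]; simp
  rw [h2, ← integral_complex_ofReal]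
  congr 1
  ext ω
  have := hXnn ω
  rw [Complex.ofReal_sub, Complex.ofReal_cpow (show 0 ≤ X ω + x by positivity),
    Complex.ofReal_cpow hx.le, Complex.ofReal_add]

lemma rderiv_aux (hX : Measurable X) (hXnn : ∀ ω, 0 ≤ X ω) {r : ℝ} (hr : r < 1)
    {x : ℝ} (hx : 0 < x) (hint : Integrable (fun ω => (X ω + x) ^ r) μ) :
    Integrable (fun ω => r * (X ω + x) ^ (r - 1)) μ ∧
    HasDerivAt (fun x => ∫ ω, (X ω + x) ^ r ∂μ) (∫ ω, r * (X ω + x) ^ (r - 1) ∂μ) x := by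
  refine hasDerivAt_integral_of_dominated_loc_of_deriv_le (μ := μ) (𝕜 := ℝ)
    (F := fun x ω => (X ω + x) ^ r)
    (F' := fun x ω => r * (X ω + x) ^ (r - 1))
    (bound := fun _ => |r| * (x / 2) ^ (r - 1)) (Ioi_mem_nhds (show x / 2 < x by linarith))
    (Eventually.of_forall fun z => Measurable.aestronglyMeasurable (by fun_prop)) hint
    (Measurable.aestronglyMeasurable (by fun_prop)) ?_ (integrable_const _) ?_
  · refine Eventually.of_forall fun ω z hz => ?_
    have hz : x / 2 < z := hz
    have := hXnn ω
    have hp : 0 < X ω + z := by linarith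
    rw [norm_mul, norm_of_nonneg (show 0 ≤ (X ω + z) ^ (r - 1) by positivity), norm_eq_abs]
    exact mul_le_mul_of_nonneg_left
      (rpow_le_rpow_of_nonpos (by linarith) (by linarith) (by linarith)) (abs_nonneg r)
  · refine Eventually.of_forall fun ω z hz => ?_
    have hz : x / 2 < z := hz
    have := hXnn ω
    have hp : 0 < X ω + z := by linarith
    have := ((hasDerivAt_id z).const_add (X ω)).rpow_const (p := r) (Or.inl hp.ne')
    simpa using this

end

lemma moments_aux {Ω Ω' : Type*} [MeasurableSpace Ω] [MeasurableSpace Ω']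
    {μ : Measure Ω} {ν : Measure Ω'} [IsProbabilityMeasure μ] [IsProbabilityMeasure ν]
    {X : Ω → ℝ} {Y : Ω' → ℝ} (hX : Measurable X) (hY : Measurable Y)
    (hXnn : ∀ ω, 0 ≤ X ω) (hYnn : ∀ ω, 0 ≤ Y ω)
    {s : ℝ} (hs1 : 0 < s) (hs2 : s < 1)
    (hi : ∀ x : ℝ, 0 < x → Integrable (fun ω => (X ω + x) ^ s) μ)
    (hj : ∀ x : ℝ, 0 < x → Integrable (fun ω => (Y ω + x) ^ s) ν)
    (h : ∀ x : ℝ, 0 < x → ∫ ω, (X ω + x) ^ s ∂μ = ∫ ω, (Y ω + x) ^ s ∂ν) (n : ℕ) :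
    ∀ x : ℝ, 0 < x → Integrable (fun ω => (X ω + x) ^ (s - n)) μ ∧
      Integrable (fun ω => (Y ω + x) ^ (s - n)) ν ∧
      ∫ ω, (X ω + x) ^ (s - n) ∂μ = ∫ ω, (Y ω + x) ^ (s - n) ∂ν := by
  induction n with
  | zero => intro x hx; simpa using ⟨hi x hx, hj x hx, h x hx⟩
  | succ n ih =>
    intro x hx
    obtain ⟨i1, i2, -⟩ := ih x hx
    have hn : s - n < 1 := by have : (0:ℝ) ≤ n := n.cast_nonneg; linarith
    have hr : s - n ≠ 0 := by
      intro h0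
      have h1 : s = n := by linarith
      rw [h1] at hs1 hs2
      norm_cast at hs1 hs2
      omega
    obtain ⟨j1, d1⟩ := rderiv_aux hX hXnn hn hx i1
    obtain ⟨j2, d2⟩ := rderiv_aux hY hYnn hn hx i2
    have e : s - ((n + 1 : ℕ) : ℝ) = s - n - 1 := by push_cast; ring
    rw [e]
    refine ⟨?_, ?_, ?_⟩
    · simpa [hr] using j1.const_mul (s - n)⁻¹
    · simpa [hr] using j2.const_mul (s - n)⁻¹
    · have hee : (fun x => ∫ ω, (X ω + x) ^ (s - n) ∂μ) =ᶠ[nhds x]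
          (fun x => ∫ ω, (Y ω + x) ^ (s - n) ∂ν) := by
        filter_upwards [Ioi_mem_nhds hx] with y hy using (ih y hy).2.2
      have := (d1.congr_of_eventuallyEq hee.symm).unique d2
      rw [integral_const_mul, integral_const_mul] at this
      exact mul_left_cancel₀ hr this

/-- Finite measures on `[0,1]` with the same moments coincide. -/
lemma ext_of_moments {P Q : Measure ℝ} [IsFiniteMeasure P] [IsFiniteMeasure Q]
    (hP : ∀ᵐ x ∂P, x ∈ Icc (0:ℝ) 1) (hQ : ∀ᵐ x ∂Q, x ∈ Icc (0:ℝ) 1)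
    (h : ∀ n : ℕ, ∫ x, x ^ n ∂P = ∫ x, x ^ n ∂Q) : P = Q := by
  have hint : ∀ (ρ : Measure ℝ) [IsFiniteMeasure ρ], (∀ᵐ x ∂ρ, x ∈ Icc (0:ℝ) 1) → ∀ n : ℕ,
      Integrable (fun x : ℝ => x ^ n) ρ := by
    intro ρ _ hρ n
    refine (integrable_const (1:ℝ)).mono' (by fun_prop) ?_
    filter_upwards [hρ] with x hx
    rw [norm_of_nonneg (pow_nonneg hx.1 n)]
    exact pow_le_one₀ hx.1 hx.2
  have hpi : ∀ (ρ : Measure ℝ) [IsFiniteMeasure ρ], (∀ᵐ x ∂ρ, x ∈ Icc (0:ℝ) 1) →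
      ∀ p : Polynomial ℝ, Integrable (fun x : ℝ => p.eval x) ρ := by
    intro ρ _ hρ p
    simp only [Polynomial.eval_eq_sum_range]
    exact integrable_finsetSum _ fun i _ => (hint ρ hρ i).const_mul _
  have hp : ∀ p : Polynomial ℝ, ∫ x, p.eval x ∂P = ∫ x, p.eval x ∂Q := by
    intro p
    simp only [Polynomial.eval_eq_sum_range]
    rw [integral_finsetSum _ fun i _ => (hint P hP i).const_mul _,
      integral_finsetSum _ fun i _ => (hint Q hQ i).const_mul _]
    simp only [integral_const_mul, h]
  apply ext_of_forall_integral_eq_of_IsFiniteMeasure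
  intro g
  have key : ∀ ε : ℝ, 0 < ε → |∫ x, g x ∂P - ∫ x, g x ∂Q| ≤ ε * (P.real univ + Q.real univ) := by
    intro ε hε
    obtain ⟨p, hpε⟩ := exists_polynomial_near_of_continuousOn 0 1 g g.continuous.continuousOn ε hε
    have hb : ∀ (ρ : Measure ℝ) [IsFiniteMeasure ρ], (∀ᵐ x ∂ρ, x ∈ Icc (0:ℝ) 1) →
        |∫ x, p.eval x ∂ρ - ∫ x, g x ∂ρ| ≤ ε * ρ.real univ := by
      intro ρ _ hρ
      rw [← integral_sub (hpi ρ hρ p) (g.integrable ρ)]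
      have hae : ∀ᵐ x ∂ρ, ‖p.eval x - g x‖ ≤ ε := by
        filter_upwards [hρ] with x hx using (hpε x hx).le
      exact norm_integral_le_of_norm_le_const hae
    have h1 := hb P hP
    have h2 := hb Q hQ
    rw [hp p] at h1
    rw [abs_le] at *
    constructor <;> linarith [h1.1, h1.2, h2.1, h2.2]
  have hlim : Tendsto (fun ε : ℝ => ε * (P.real univ + Q.real univ)) (nhdsWithin 0 (Ioi 0))
      (nhds (0 * (P.real univ + Q.real univ))) :=
    (tendsto_id.mono_left nhdsWithin_le_nhds).mul_const _
  have := ge_of_tendsto hlim (by filter_upwards [self_mem_nhdsWithin] with ε hε using key ε hε)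
  rw [zero_mul] at this
  exact sub_eq_zero.1 (abs_nonpos_iff.1 this)

section
variable {Ω : Type*} [MeasurableSpace Ω] (μ : Measure Ω) [IsProbabilityMeasure μ] (X : Ω → ℝ)

noncomputable def tilt (s : ℝ) : Measure ℝ :=
  Measure.map (fun ω => (X ω + 1)⁻¹) (μ.withDensity fun ω => ENNReal.ofReal ((X ω + 1) ^ (s - 1)))

variable {μ X}

lemma tilt_finite (hXnn : ∀ ω, 0 ≤ X ω) {s : ℝ} (hs2 : s < 1) : IsFiniteMeasure (tilt μ X s) := by
  have : IsFiniteMeasure (μ.withDensity fun ω => ENNReal.ofReal ((X ω + 1) ^ (s - 1))) := by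
    apply isFiniteMeasure_withDensity
    refine ((lintegral_mono (g := fun _ => 1) fun ω => ?_).trans_lt (by simp)).ne
    rw [← ENNReal.ofReal_one]
    apply ENNReal.ofReal_le_ofReal
    exact rpow_le_one_of_one_le_of_nonpos (by linarith [hXnn ω]) (by linarith)
  unfold tilt; infer_instance

lemma tilt_supp (hX : Measurable X) (hXnn : ∀ ω, 0 ≤ X ω) (s : ℝ) :
    ∀ᵐ x ∂(tilt μ X s), x ∈ Icc (0:ℝ) 1 := by
  unfold tilt
  refine (ae_map_iff (p := fun x => x ∈ Icc (0:ℝ) 1) (by fun_prop) measurableSet_Icc).2 ?_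
  refine Eventually.of_forall fun ω => ⟨?_, ?_⟩
  · have := hXnn ω; positivity
  · exact inv_le_one_of_one_le₀ (by linarith [hXnn ω])

lemma tilt_moment (hX : Measurable X) (hXnn : ∀ ω, 0 ≤ X ω) (s : ℝ) (n : ℕ) :
    ∫ x, x ^ n ∂(tilt μ X s) = ∫ ω, (X ω + 1) ^ (s - ((n + 1 : ℕ) : ℝ)) ∂μ := by
  unfold tilt
  rw [integral_map (by fun_prop) (by fun_prop),
    integral_withDensity_eq_integral_toReal_smul (by fun_prop) (by simp)]
  congr 1
  ext ω
  have : 0 < X ω + 1 := by linarith [hXnn ω]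
  rw [ENNReal.toReal_ofReal (by positivity), smul_eq_mul, inv_pow, ← rpow_natCast, ← rpow_neg this.le,
    ← rpow_add this]
  congr 1
  push_cast; ring

lemma tilt_law (hX : Measurable X) (hXnn : ∀ ω, 0 ≤ X ω) (s : ℝ) {A : Set ℝ}
    (hA : MeasurableSet A) :
    Measure.map X μ A = ∫⁻ u, (A.indicator (fun _ => (1 : ENNReal)) (u⁻¹ - 1)) *
      ENNReal.ofReal (u ^ (s - 1)) ∂(tilt μ X s) := by
  have hm : Measurable (A.indicator (fun _ => (1 : ENNReal))) := measurable_const.indicator hA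
  unfold tilt
  rw [lintegral_map (by fun_prop) (by fun_prop),
    lintegral_withDensity_eq_lintegral_mul _ (by fun_prop) (by fun_prop),
    ← lintegral_indicator_one hA, lintegral_map (f := A.indicator 1) hm hX]
  congr 1
  ext ω
  have : 0 < X ω + 1 := by linarith [hXnn ω]
  simp only [Pi.mul_apply, inv_inv, add_sub_cancel_right]
  rw [mul_left_comm, ← ENNReal.ofReal_mul (by positivity), ← mul_rpow this.le (by positivity),
    mul_inv_cancel₀ this.ne', one_rpow, ENNReal.ofReal_one, mul_one]
  rfl

lemma int_of_lint (hX : Measurable X) {c s : ℝ} (hc : ∀ ω, 0 ≤ X ω + c)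
    (h : ∫⁻ ω, ENNReal.ofReal ((X ω + c) ^ s) ∂μ ≠ ⊤) :
    Integrable (fun ω => (X ω + c) ^ s) μ := by
  refine ⟨Measurable.aestronglyMeasurable (by fun_prop), ?_⟩
  rw [hasFiniteIntegral_iff_ofReal (Eventually.of_forall fun ω => rpow_nonneg (hc ω) s)]
  exact lt_top_iff_ne_top.2 h

end

theorem stmt13 {Ω Ω' : Type*} [MeasurableSpace Ω] [MeasurableSpace Ω']
    (μ : Measure Ω) (ν : Measure Ω') [IsProbabilityMeasure μ] [IsProbabilityMeasure ν]
    (X : Ω → ℝ) (Y : Ω' → ℝ) (hX : Measurable X) (hY : Measurable Y)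
    (hXnn : ∀ ω, 0 ≤ X ω) (hYnn : ∀ ω, 0 ≤ Y ω)
    (s : ℝ) (hs1 : 0 < s) (hs2 : s < 1)
    (hmom_eq : ∫⁻ ω, ENNReal.ofReal (X ω ^ s) ∂μ = ∫⁻ ω, ENNReal.ofReal (Y ω ^ s) ∂ν)
    (hmom_pos : ∫⁻ ω, ENNReal.ofReal (X ω ^ s) ∂μ ≠ 0)
    (hmom_fin : ∫⁻ ω, ENNReal.ofReal (X ω ^ s) ∂μ ≠ ⊤)
    (a : ℕ → ℝ) (ha_pos : ∀ k, 0 < a k) (ha_inj : Function.Injective a)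
    (ha_cond :
      (Tendsto a atTop atTop ∧ ¬ Summable (fun k => 1 / a k))
        ∨ (∃ a₀ : ℝ, 0 < a₀ ∧ Tendsto a atTop (nhds a₀))
        ∨ (Tendsto a atTop (nhds 0) ∧ ¬ Summable a))
    (htrans : ∀ k : ℕ,
      ∫⁻ ω, ENNReal.ofReal ((X ω + a k) ^ s) ∂μ
        = ∫⁻ ω, ENNReal.ofReal ((Y ω + a k) ^ s) ∂ν) :
    Measure.map X μ = Measure.map Y ν := by
  have iX : Integrable (fun ω => X ω ^ s) μ := by
    simpa using int_of_lint (c := 0) hX (by simpa using hXnn) (by simpa using hmom_fin)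
  have iY : Integrable (fun ω => Y ω ^ s) ν := by
    simpa using int_of_lint (c := 0) hY (by simpa using hYnn) (by simpa [← hmom_eq] using hmom_fin)
  have rX := fun (x : ℝ) (hx : 0 < x) => rint_aux hX hXnn hs1 hs2 iX hx
  have rY := fun (x : ℝ) (hx : 0 < x) => rint_aux hY hYnn hs1 hs2 iY hx
  have hz : ∀ k, ∫ ω, (X ω + a k) ^ s ∂μ = ∫ ω, (Y ω + a k) ^ s ∂ν := by
    intro k
    have hk := ha_pos k
    rw [integral_eq_lintegral_of_nonneg_ae
        (Eventually.of_forall fun ω => rpow_nonneg (by linarith [hXnn ω]) s)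
        (rX _ hk).1.aestronglyMeasurable,
      integral_eq_lintegral_of_nonneg_ae
        (Eventually.of_forall fun ω => rpow_nonneg (by linarith [hYnn ω]) s)
        (rY _ hk).1.aestronglyMeasurable, htrans k]
  have hall : ∀ x : ℝ, 0 < x → ∫ ω, (X ω + x) ^ s ∂μ = ∫ ω, (Y ω + x) ^ s ∂ν := by
    intro x hx
    have h0 := zero_of_zeros
      ((diff_aux hX hXnn hs1 hs2 iX).sub (diff_aux hY hYnn hs1 hs2 iY))
      (M := ∫ ω, 3 * X ω ^ s ∂μ + ∫ ω, 3 * Y ω ^ s ∂ν)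
      (fun z hz => (norm_sub_le _ _).trans
        (add_le_add (bound_aux hXnn hs1 hs2 iX hz) (bound_aux hYnn hs1 hs2 iY hz)))
      ha_pos ha_inj ha_cond
      (by
        intro k
        have hk := ha_pos k
        simp only [Pi.sub_apply]
        rw [(rX _ hk).2, (rY _ hk).2, hz k, sub_self]) hx
    simp only [Pi.sub_apply] at h0
    rw [(rX _ hx).2, (rY _ hx).2, ← Complex.ofReal_sub, Complex.ofReal_eq_zero] at h0
    linarith
  have hmom := moments_aux hX hY hXnn hYnn hs1 hs2 (fun x hx => (rX x hx).1)
    (fun x hx => (rY x hx).1) hall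
  have := tilt_finite (μ := μ) hXnn hs2
  have := tilt_finite (μ := ν) hYnn hs2
  have htilt : tilt μ X s = tilt ν Y s :=
    ext_of_moments (tilt_supp hX hXnn s) (tilt_supp hY hYnn s) fun n => by
      rw [tilt_moment hX hXnn, tilt_moment hY hYnn]
      exact (hmom (n + 1) 1 one_pos).2.2
  ext A hA
  rw [tilt_law hX hXnn s hA, tilt_law hY hYnn s hA, htilt]
end

section
/- Let X and Y be nonnegative random variables with E[X^s] = E[Y^s] ∈ (0,∞) for some s ∈ (n, n+1), where n ≥ 1 is an integer, and let {a_k}_{k=1}^∞ be a sequence of positive, pairwise distinct real numbers satisfying lim_{k→∞} a_k = ∞ and Σ_{k=1}^∞ 1/a_k = ∞. If E[(X+a_k)^s] = E[(Y+a_k)^s] and E[(X+2a_k)^s] = E[(Y+2a_k)^s] for all k ≥ 1, then X and Y have the same distribution. -/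
open MeasureTheory Real Set Filter

lemma schwarz_step (M : ℝ) (f : ℂ → ℂ) (a : ℝ) (ha : 0 < a)
    (hd : DifferentiableOn ℂ f {z | 0 < z.re}) (hb : ∀ z : ℂ, 0 < z.re → ‖f z‖ ≤ M)
    (h0 : f a = 0) :
    ∃ g : ℂ → ℂ, DifferentiableOn ℂ g {z | 0 < z.re} ∧ (∀ z : ℂ, 0 < z.re → ‖g z‖ ≤ M) ∧
      ∀ z : ℂ, 0 < z.re → f z = (z - a) / (z + a) * g z := by
  have hac : (a : ℂ) ≠ 0 := by exact_mod_cast ha.ne'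
  have hne : ∀ w : ℂ, ‖w‖ < 1 → 1 - w ≠ 0 := by
    intro w hw h
    have : w = 1 := by linear_combination -h
    rw [this] at hw; simp at hw
  have hre : ∀ w : ℂ, ‖w‖ < 1 → 0 < ((a : ℂ) * ((1 + w) / (1 - w))).re := by
    intro w hw
    have h1 := hne w hw
    have h2 : w.re * w.re + w.im * w.im < 1 := by
      rw [← Complex.normSq_apply, Complex.normSq_eq_norm_sq]
      have := norm_nonneg w
      nlinarith
    rw [Complex.re_ofReal_mul]
    apply mul_pos ha
    rw [Complex.div_re, ← add_div]
    apply div_pos _ (Complex.normSq_pos.2 h1)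
    simp
    nlinarith
  have hplus : ∀ z : ℂ, 0 < z.re → z + a ≠ 0 := by
    intro z hz h
    have := congrArg Complex.re h
    simp at this; linarith
  have hnorm : ∀ z : ℂ, 0 < z.re → ‖(z - a) / (z + a)‖ < 1 := by
    intro z hz
    rw [norm_div, div_lt_one (norm_pos_iff.2 (hplus z hz))]
    apply lt_of_pow_lt_pow_left₀ 2 (norm_nonneg _)
    rw [← Complex.normSq_eq_norm_sq, ← Complex.normSq_eq_norm_sq, Complex.normSq_apply,
      Complex.normSq_apply]
    simp
    nlinarith [mul_pos hz ha]
  let h : ℂ → ℂ := fun w => f (a * ((1 + w) / (1 - w)))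
  have hh0 : h 0 = 0 := by simp [h, h0]
  have hhd : DifferentiableOn ℂ h (Metric.ball 0 1) := by
    apply hd.comp
    · intro w hw
      have := hne w (by simpa using hw)
      apply DifferentiableAt.differentiableWithinAt
      fun_prop (disch := assumption)
    · intro w hw
      exact hre w (by simpa using hw)
  have hmaps : MapsTo h (Metric.ball 0 1) (Metric.closedBall (h 0) M) := by
    intro w hw
    rw [hh0]
    simpa [h] using hb _ (hre w (by simpa using hw))
  have hgd : DifferentiableOn ℂ (dslope h 0) (Metric.ball 0 1) :=
    (Complex.differentiableOn_dslope (Metric.ball_mem_nhds _ one_pos)).2 hhd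
  refine ⟨fun z => dslope h 0 ((z - a) / (z + a)), ?_, ?_, ?_⟩
  · apply hgd.comp (t := Metric.ball 0 1)
    · intro z hz
      have := hplus z hz
      apply DifferentiableAt.differentiableWithinAt
      fun_prop (disch := assumption)
    · intro z hz
      simpa using hnorm z hz
  · intro z hz
    have := Complex.norm_dslope_le_div_of_mapsTo_ball hhd hmaps
      (z := (z - a) / (z + a)) (by simpa using hnorm z hz)
    simpa using this
  · intro z hz
    have h1 := sub_smul_dslope h 0 ((z - a) / (z + a))
    rw [hh0, sub_zero, sub_zero, smul_eq_mul] at h1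
    rw [h1]
    simp only [h]
    congr 1
    have := hplus z hz
    have h2 : 1 - (z - a) / (z + a) = 2 * a / (z + a) := by field_simp; ring
    have h3 : 1 + (z - a) / (z + a) = 2 * z / (z + a) := by field_simp; ring
    rw [h2, h3]
    field_simp

lemma blaschke_bound (M : ℝ) (N : ℕ) : ∀ (f : ℂ → ℂ) (a : ℕ → ℝ), (∀ k, 0 < a k) →
    Function.Injective a →
    DifferentiableOn ℂ f {z | 0 < z.re} → (∀ z : ℂ, 0 < z.re → ‖f z‖ ≤ M) →
    (∀ k, f (a k) = 0) → ∀ z : ℂ, 0 < z.re →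
    ‖f z‖ ≤ M * ∏ k ∈ Finset.range N, ‖(z - a k) / (z + a k)‖ := by
  induction N with
  | zero => intro f a _ _ _ hb _ z hz; simpa using hb z hz
  | succ N ih =>
    intro f a ha hinj hd hb h0 z hz
    obtain ⟨g, hgd, hgb, hg⟩ := schwarz_step M f (a 0) (ha 0) hd hb (h0 0)
    have := ih g (fun k => a (k + 1)) (fun k => ha _) (fun i j hij => by simpa using hinj hij)
      hgd hgb (by
        intro k
        have h1 := hg (a (k + 1)) (by simpa using ha (k + 1))
        rw [h0] at h1
        have h2 : ((a (k + 1) : ℂ) - a 0) / (a (k + 1) + a 0) ≠ 0 := by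
          apply div_ne_zero
          · rw [sub_ne_zero]
            intro h
            have := hinj (Complex.ofReal_injective h)
            omega
          · have := ha (k + 1); have := ha 0
            exact_mod_cast (by positivity : a (k + 1) + a 0 ≠ 0)
        exact (mul_eq_zero.1 h1.symm).resolve_left h2) z hz
    rw [Finset.prod_range_succ', hg z hz, norm_mul]
    calc _ ≤ ‖(z - a 0) / (z + a 0)‖ *
          (M * ∏ k ∈ Finset.range N, ‖(z - a (k + 1)) / (z + a (k + 1))‖) := by gcongr
      _ = _ := by rw [mul_comm, mul_assoc]

lemma factor_bound (a : ℝ) (ha : 0 < a) (z : ℂ) (hz : 0 < z.re) :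
    ‖(z - a) / (z + a)‖ ≤ Real.exp (-(2 * a * z.re / ‖z + a‖ ^ 2)) := by
  have hp : 0 < ‖z + a‖ := by
    rw [norm_pos_iff]
    intro h
    have := congrArg Complex.re h
    simp at this; linarith
  apply le_of_sq_le_sq _ (Real.exp_pos _).le
  rw [← Real.exp_nat_mul, norm_div, div_pow]
  have h : ‖z - a‖ ^ 2 = ‖z + a‖ ^ 2 - 4 * a * z.re := by
    rw [← Complex.normSq_eq_norm_sq, ← Complex.normSq_eq_norm_sq, Complex.normSq_apply,
      Complex.normSq_apply]
    simp; ring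
  rw [h, sub_div, div_self (by positivity)]
  have := Real.add_one_le_exp (-(4 * a * z.re / ‖z + a‖ ^ 2))
  calc _ = -(4 * a * z.re / ‖z + a‖ ^ 2) + 1 := by ring
    _ ≤ _ := this
    _ = _ := by congr 1; push_cast; ring

lemma blaschke_zero (M : ℝ) (f : ℂ → ℂ) (a : ℕ → ℝ) (ha : ∀ k, 0 < a k)
    (hinj : Function.Injective a) (ha_lim : Tendsto a atTop atTop)
    (ha_sum : ¬ Summable (fun k => 1 / a k))
    (hd : DifferentiableOn ℂ f {z | 0 < z.re}) (hb : ∀ z : ℂ, 0 < z.re → ‖f z‖ ≤ M)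
    (h0 : ∀ k, f (a k) = 0) (z : ℂ) (hz : 0 < z.re) : f z = 0 := by
  have hM : 0 ≤ M := (norm_nonneg _).trans (hb z hz)
  let u : ℕ → ℝ := fun k => 2 * a k * z.re / ‖z + a k‖ ^ 2
  have hu0 : ∀ k, 0 ≤ u k := fun k => by have := (ha k).le; have := hz.le; positivity
  have hu : ¬ Summable u := by
    intro hs
    apply ha_sum
    have hs2 := hs.mul_left (2 / z.re)
    refine Summable.of_norm_bounded_eventually_nat hs2 ?_
    filter_upwards [ha_lim.eventually_ge_atTop ‖z‖] with k hk
    have hak := ha k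
    rw [Real.norm_of_nonneg (by positivity)]
    have hp : 0 < ‖z + a k‖ := by
      rw [norm_pos_iff]
      intro h
      have := congrArg Complex.re h
      simp at this; linarith
    have h1 : ‖z + a k‖ ≤ 2 * a k := by
      refine (norm_add_le _ _).trans ?_
      rw [Complex.norm_real, Real.norm_of_nonneg hak.le]; linarith
    have h2 : 2 / z.re * u k = 4 * a k / ‖z + a k‖ ^ 2 := by
      simp only [u]; field_simp; ring
    rw [h2, div_le_div_iff₀ hak (by positivity)]
    nlinarith
  have ht : Tendsto (fun N => ∑ k ∈ Finset.range N, u k) atTop atTop :=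
    (not_summable_iff_tendsto_nat_atTop_of_nonneg hu0).1 hu
  have ht2 : Tendsto (fun N => M * Real.exp (-∑ k ∈ Finset.range N, u k)) atTop (nhds 0) := by
    have := (Real.tendsto_exp_neg_atTop_nhds_zero.comp ht).const_mul M
    simpa using this
  have hle : ∀ N, ‖f z‖ ≤ M * Real.exp (-∑ k ∈ Finset.range N, u k) := by
    intro N
    refine (blaschke_bound M N f a ha hinj hd hb h0 z hz).trans ?_
    gcongr
    rw [← Finset.sum_neg_distrib, Real.exp_sum]
    exact Finset.prod_le_prod (fun _ _ => norm_nonneg _) (fun k _ => factor_bound _ (ha k) z hz)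
  have := ge_of_tendsto' ht2 hle
  exact norm_le_zero_iff.1 this

lemma integrable_shift {Ω : Type*} [MeasurableSpace Ω] (μ : Measure Ω) [IsProbabilityMeasure μ]
    (X : Ω → ℝ) (hX : Measurable X) (hXnn : ∀ ω, 0 ≤ X ω) (s : ℝ) (hs : 0 < s)
    (hi : Integrable (fun ω => X ω ^ s) μ) (r : ℝ) (hr : r ≤ s) (c : ℝ) (hc : 0 < c) :
    Integrable (fun ω => (X ω + c) ^ r) μ := by
  have hb : Integrable (fun ω => c ^ (r - s) * (2 ^ s * (X ω ^ s + c ^ s))) μ :=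
    ((hi.add (integrable_const _)).const_mul _).const_mul _
  refine hb.mono' (Measurable.aestronglyMeasurable (by fun_prop)) (ae_of_all _ fun ω => ?_)
  have hx := hXnn ω
  have hxc : 0 < X ω + c := by positivity
  rw [Real.norm_of_nonneg (by positivity)]
  have h1 : (X ω + c) ^ r = (X ω + c) ^ (r - s) * (X ω + c) ^ s := by
    rw [← Real.rpow_add hxc]; congr 1; ring
  rw [h1]
  gcongr ?_ * ?_
  · exact Real.rpow_le_rpow_of_nonpos hc (by linarith) (by linarith)
  · calc (X ω + c) ^ s ≤ (2 * max (X ω) c) ^ s := by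
          apply Real.rpow_le_rpow hxc.le _ hs.le
          linarith [le_max_left (X ω) c, le_max_right (X ω) c]
      _ = 2 ^ s * (max (X ω) c) ^ s := by
          rw [Real.mul_rpow (by norm_num) (le_max_of_le_left hx)]
      _ ≤ 2 ^ s * (X ω ^ s + c ^ s) := by
          gcongr
          rcases max_choice (X ω) c with h | h <;> rw [h]
          · have : 0 ≤ c ^ s := by positivity
            linarith
          · have : 0 ≤ X ω ^ s := by positivity
            linarith

lemma norm_bound (x c C r : ℝ) (hx : 0 ≤ x) (hc : 0 < c) (z : ℂ) (h1 : c ≤ z.re)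
    (h2 : ‖z‖ ≤ C) : ‖((x : ℂ) + z) ^ (r : ℂ)‖ ≤ (x + c) ^ r + (x + C) ^ r := by
  rw [Complex.norm_cpow_real]
  have hC : 0 ≤ C := (norm_nonneg _).trans h2
  have ha : x + c ≤ ‖(x : ℂ) + z‖ := by
    refine le_trans ?_ (Complex.re_le_norm _)
    simp; linarith
  have hb : ‖(x : ℂ) + z‖ ≤ x + C := by
    refine (norm_add_le _ _).trans ?_
    rw [Complex.norm_real, Real.norm_of_nonneg hx]; linarith
  have e1 : 0 ≤ (x + c) ^ r := by positivity
  have e2 : 0 ≤ (x + C) ^ r := by positivity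
  rcases le_total 0 r with h | h
  · have := Real.rpow_le_rpow (norm_nonneg _) hb h
    linarith
  · have := Real.rpow_le_rpow_of_nonpos (by linarith) ha h
    linarith

lemma integrable_cpow {Ω : Type*} [MeasurableSpace Ω] (μ : Measure Ω) [IsProbabilityMeasure μ]
    (X : Ω → ℝ) (hX : Measurable X) (hXnn : ∀ ω, 0 ≤ X ω) (s : ℝ) (hs : 0 < s)
    (hi : Integrable (fun ω => X ω ^ s) μ) (r : ℝ) (hr : r ≤ s) (z : ℂ) (hz : 0 < z.re) :
    Integrable (fun ω => ((X ω : ℂ) + z) ^ (r : ℂ)) μ := by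
  have hn : 0 < ‖z‖ := lt_of_lt_of_le hz (Complex.re_le_norm z)
  refine ((integrable_shift μ X hX hXnn s hs hi r hr z.re hz).add
    (integrable_shift μ X hX hXnn s hs hi r hr ‖z‖ hn)).mono'
    (Measurable.aestronglyMeasurable (by fun_prop)) (ae_of_all _ fun ω => ?_)
  exact norm_bound _ _ _ _ (hXnn ω) hz z le_rfl le_rfl

lemma hasDerivAt_G {Ω : Type*} [MeasurableSpace Ω] (μ : Measure Ω) [IsProbabilityMeasure μ]
    (X : Ω → ℝ) (hX : Measurable X) (hXnn : ∀ ω, 0 ≤ X ω) (s : ℝ) (hs : 0 < s)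
    (hi : Integrable (fun ω => X ω ^ s) μ) (r : ℝ) (hr : r ≤ s) (z : ℂ) (hz : 0 < z.re) :
    HasDerivAt (fun z : ℂ => ∫ ω, ((X ω : ℂ) + z) ^ (r : ℂ) ∂μ)
      (r * ∫ ω, ((X ω : ℂ) + z) ^ ((r - 1 : ℝ) : ℂ) ∂μ) z := by
  rw [← integral_const_mul]
  set c := z.re / 2 with hcdef
  have hc : 0 < c := by positivity
  have hC : 0 < ‖z‖ + c := by positivity
  have hball : ∀ w ∈ Metric.ball z c, c ≤ w.re ∧ ‖w‖ ≤ ‖z‖ + c := by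
    intro w hw
    rw [Metric.mem_ball, dist_eq_norm] at hw
    constructor
    · have := (Complex.abs_re_le_norm (w - z)).trans hw.le
      rw [abs_le, Complex.sub_re] at this
      linarith [this.1]
    · have := norm_sub_norm_le w z
      linarith
  refine (hasDerivAt_integral_of_dominated_loc_of_deriv_le (s := Metric.ball z c)
    (F := fun z ω => ((X ω : ℂ) + z) ^ (r : ℂ))
    (F' := fun z ω => r * ((X ω : ℂ) + z) ^ ((r - 1 : ℝ) : ℂ))
    (bound := fun ω => |r| * ((X ω + c) ^ (r - 1) + (X ω + (‖z‖ + c)) ^ (r - 1)))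
    (Metric.ball_mem_nhds z hc)
    (Eventually.of_forall fun w => Measurable.aestronglyMeasurable (by fun_prop))
    (integrable_cpow μ X hX hXnn s hs hi r hr z hz)
    (Measurable.aestronglyMeasurable (by fun_prop))
    (ae_of_all _ fun ω w hw => ?_) ?_ (ae_of_all _ fun ω w hw => ?_)).2
  · rw [norm_mul, Complex.norm_real, Real.norm_eq_abs]
    gcongr
    exact norm_bound _ _ _ _ (hXnn ω) hc w (hball w hw).1 (hball w hw).2
  · exact ((integrable_shift μ X hX hXnn s hs hi (r-1) (by linarith) _ hc).add
      (integrable_shift μ X hX hXnn s hs hi (r-1) (by linarith) _ hC)).const_mul _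
  · have h1 : HasDerivAt (fun w : ℂ => (X ω : ℂ) + w) 1 w := (hasDerivAt_id w).const_add _
    have := h1.cpow_const (c := (r : ℂ)) (Or.inl (by
      have := (hball w hw).1; have := hXnn ω
      simp; linarith))
    simpa using this

lemma G_real {Ω : Type*} [MeasurableSpace Ω] (μ : Measure Ω)
    (X : Ω → ℝ) (hXnn : ∀ ω, 0 ≤ X ω) (r t : ℝ) (ht : 0 < t) :
    ∫ ω, ((X ω : ℂ) + (t : ℂ)) ^ (r : ℂ) ∂μ = ((∫ ω, (X ω + t) ^ r ∂μ : ℝ) : ℂ) := by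
  rw [← integral_complex_ofReal]
  congr 1; ext ω
  have := hXnn ω
  rw [Complex.ofReal_cpow (by positivity)]
  push_cast; rfl

lemma G_growth {Ω : Type*} [MeasurableSpace Ω] (μ : Measure Ω) [IsProbabilityMeasure μ]
    (X : Ω → ℝ) (hX : Measurable X) (hXnn : ∀ ω, 0 ≤ X ω) (s : ℝ) (hs : 0 < s)
    (hi : Integrable (fun ω => X ω ^ s) μ) (z : ℂ) (hz : 0 < z.re) :
    ‖∫ ω, ((X ω : ℂ) + z) ^ (s : ℂ) ∂μ‖ ≤ (∫ ω, (X ω + 1) ^ s ∂μ) * ‖(z + 1) ^ (s : ℂ)‖ := by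
  rw [← integral_mul_const]
  apply norm_integral_le_of_norm_le
  · exact (integrable_shift μ X hX hXnn s hs hi s le_rfl 1 one_pos).mul_const _
  · refine ae_of_all _ fun ω => ?_
    have hx := hXnn ω
    rw [Complex.norm_cpow_real, Complex.norm_cpow_real, ← Real.mul_rpow (by positivity) (norm_nonneg _)]
    apply Real.rpow_le_rpow (norm_nonneg _) _ hs.le
    have h1 : (1 : ℝ) ≤ ‖z + 1‖ := by
      refine le_trans ?_ (Complex.re_le_norm _)
      simp; linarith
    have h2 : ‖z‖ ≤ ‖z + 1‖ := by
      apply le_of_sq_le_sq _ (norm_nonneg _)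
      rw [← Complex.normSq_eq_norm_sq, ← Complex.normSq_eq_norm_sq, Complex.normSq_apply,
        Complex.normSq_apply]
      simp; nlinarith
    refine (norm_add_le _ _).trans ?_
    rw [Complex.norm_real, Real.norm_of_nonneg hx]
    nlinarith

lemma integrable_cont_of_supp (m : Measure ℝ) [IsFiniteMeasure m]
    (h : ∀ᵐ x ∂m, x ∈ Icc (0 : ℝ) 1) (f : ℝ → ℝ) (hf : Continuous f) : Integrable f m := by
  obtain ⟨C, hC⟩ := isCompact_Icc.exists_bound_of_continuousOn (hf.continuousOn (s := Icc (0:ℝ) 1))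
  exact Integrable.of_bound hf.aestronglyMeasurable C (h.mono fun x hx => hC x hx)

lemma moments_ext (m₁ m₂ : Measure ℝ) [IsFiniteMeasure m₁] [IsFiniteMeasure m₂]
    (h₁ : ∀ᵐ x ∂m₁, x ∈ Icc (0 : ℝ) 1) (h₂ : ∀ᵐ x ∂m₂, x ∈ Icc (0 : ℝ) 1)
    (hm : ∀ j : ℕ, ∫ x, x ^ j ∂m₁ = ∫ x, x ^ j ∂m₂) : m₁ = m₂ := by
  have hpoly : ∀ p : Polynomial ℝ, ∫ x, p.eval x ∂m₁ = ∫ x, p.eval x ∂m₂ := by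
    intro p
    simp only [Polynomial.eval_eq_sum_range]
    rw [integral_finsetSum _ fun i _ => integrable_cont_of_supp m₁ h₁ _ (by fun_prop),
      integral_finsetSum _ fun i _ => integrable_cont_of_supp m₂ h₂ _ (by fun_prop)]
    simp only [integral_const_mul, hm]
  apply ext_of_forall_integral_eq_of_IsFiniteMeasure
  intro f
  have key : ∀ ε > 0, |∫ x, f x ∂m₁ - ∫ x, f x ∂m₂| ≤ ε * (m₁.real univ + m₂.real univ) := by
    intro ε hε
    obtain ⟨p, hp⟩ := exists_polynomial_near_of_continuousOn 0 1 f f.continuous.continuousOn ε hε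
    have aux : ∀ (m : Measure ℝ) [IsFiniteMeasure m], (∀ᵐ x ∂m, x ∈ Icc (0 : ℝ) 1) →
        |∫ x, p.eval x ∂m - ∫ x, f x ∂m| ≤ ε * m.real univ := by
      intro m _ h
      rw [← integral_sub (integrable_cont_of_supp m h _ (by fun_prop))
        (integrable_cont_of_supp m h _ f.continuous)]
      rw [← Real.norm_eq_abs]
      exact norm_integral_le_of_norm_le_const (h.mono fun x hx => by
        rw [Real.norm_eq_abs]; exact (hp x hx).le)
    have a1 := aux m₁ h₁
    have a2 := aux m₂ h₂
    rw [hpoly p] at a1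
    rw [abs_le] at *
    constructor <;> linarith [a1.1, a1.2, a2.1, a2.2]
  by_contra hne
  have hpos : 0 < |∫ x, f x ∂m₁ - ∫ x, f x ∂m₂| := abs_pos.2 (sub_ne_zero.2 hne)
  set D := |∫ x, f x ∂m₁ - ∫ x, f x ∂m₂|
  have hT : 0 ≤ m₁.real univ + m₂.real univ := by positivity
  set T := m₁.real univ + m₂.real univ
  have := key (D / (2 * (T + 1))) (by positivity)
  rw [div_mul_eq_mul_div, le_div_iff₀ (by positivity)] at this
  nlinarith

noncomputable def wmeas {Ω : Type*} [MeasurableSpace Ω] (μ : Measure Ω) (X : Ω → ℝ) (s : ℝ) :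
    Measure ℝ :=
  (μ.withDensity (fun ω => ENNReal.ofReal ((X ω + 1) ^ s))).map (fun ω => (X ω + 1)⁻¹)

lemma wmeas_finite {Ω : Type*} [MeasurableSpace Ω] (μ : Measure Ω)
    (X : Ω → ℝ) (s : ℝ)
    (hi : Integrable (fun ω => (X ω + 1) ^ s) μ) : IsFiniteMeasure (wmeas μ X s) := by
  have := isFiniteMeasure_withDensity_ofReal hi.2
  unfold wmeas
  infer_instance

lemma wmeas_supp {Ω : Type*} [MeasurableSpace Ω] (μ : Measure Ω)
    (X : Ω → ℝ) (hX : Measurable X) (hXnn : ∀ ω, 0 ≤ X ω) (s : ℝ) :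
    ∀ᵐ x ∂(wmeas μ X s), x ∈ Icc (0 : ℝ) 1 := by
  unfold wmeas
  refine (ae_map_iff (p := fun x => x ∈ Icc (0 : ℝ) 1) (by fun_prop) measurableSet_Icc).2 ?_
  refine ae_of_all _ fun ω => ?_
  have := hXnn ω
  exact ⟨by positivity, inv_le_one_of_one_le₀ (by linarith)⟩

lemma wmeas_moment {Ω : Type*} [MeasurableSpace Ω] (μ : Measure Ω)
    (X : Ω → ℝ) (hX : Measurable X) (hXnn : ∀ ω, 0 ≤ X ω) (s : ℝ) (j : ℕ) :
    ∫ x, x ^ j ∂(wmeas μ X s) = ∫ ω, (X ω + 1) ^ (s - j) ∂μ := by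
  unfold wmeas
  rw [integral_map (by fun_prop) (by fun_prop)]
  rw [integral_withDensity_eq_integral_toReal_smul (by fun_prop) (by simp)]
  congr 1; ext ω
  have := hXnn ω
  rw [ENNReal.toReal_ofReal (by positivity), Real.rpow_sub (by positivity), Real.rpow_natCast,
    smul_eq_mul, inv_pow, div_eq_mul_inv]

lemma wmeas_recover {Ω : Type*} [MeasurableSpace Ω] (μ : Measure Ω)
    (X : Ω → ℝ) (hX : Measurable X) (hXnn : ∀ ω, 0 ≤ X ω) (s : ℝ) (A : Set ℝ)
    (hA : MeasurableSet A) :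
    μ.map X A = ∫⁻ w, A.indicator 1 (w⁻¹ - 1) * ENNReal.ofReal (w ^ s) ∂(wmeas μ X s) := by
  have hind : Measurable (A.indicator (1 : ℝ → ENNReal)) := measurable_one.indicator hA
  unfold wmeas
  rw [lintegral_map (by fun_prop) (by fun_prop), lintegral_withDensity_eq_lintegral_mul _
    (by fun_prop) (by fun_prop), ← lintegral_indicator_one hA, lintegral_map hind hX]
  congr 1; ext ω
  have := hXnn ω
  have h1 : 0 < X ω + 1 := by positivity
  simp only [Pi.mul_apply, inv_inv, add_sub_cancel_right]
  rw [mul_left_comm, ← ENNReal.ofReal_mul (by positivity), ← Real.mul_rpow h1.le (by positivity),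
    mul_inv_cancel₀ h1.ne']
  simp

lemma integrable_of_lint {Ω : Type*} [MeasurableSpace Ω] (μ : Measure Ω)
    (X : Ω → ℝ) (hX : Measurable X) (hXnn : ∀ ω, 0 ≤ X ω) (s : ℝ)
    (h : ∫⁻ ω, ENNReal.ofReal (X ω ^ s) ∂μ ≠ ⊤) : Integrable (fun ω => X ω ^ s) μ := by
  refine ⟨Measurable.aestronglyMeasurable (by fun_prop), ?_⟩
  rw [hasFiniteIntegral_iff_ofReal (ae_of_all _ fun ω => Real.rpow_nonneg (hXnn ω) s)]
  exact lt_top_iff_ne_top.2 h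

theorem stmt14 {Ω Ω' : Type*} [MeasurableSpace Ω] [MeasurableSpace Ω']
    (μ : Measure Ω) (ν : Measure Ω') [IsProbabilityMeasure μ] [IsProbabilityMeasure ν]
    (X : Ω → ℝ) (Y : Ω' → ℝ) (hX : Measurable X) (hY : Measurable Y)
    (hXnn : ∀ ω, 0 ≤ X ω) (hYnn : ∀ ω, 0 ≤ Y ω)
    (n : ℕ) (hn : 1 ≤ n) (s : ℝ) (hs1 : (n : ℝ) < s) (hs2 : s < n + 1)
    (hmom_eq : ∫⁻ ω, ENNReal.ofReal (X ω ^ s) ∂μ = ∫⁻ ω, ENNReal.ofReal (Y ω ^ s) ∂ν)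
    (hmom_pos : ∫⁻ ω, ENNReal.ofReal (X ω ^ s) ∂μ ≠ 0)
    (hmom_fin : ∫⁻ ω, ENNReal.ofReal (X ω ^ s) ∂μ ≠ ⊤)
    (a : ℕ → ℝ) (ha_pos : ∀ k, 0 < a k) (ha_inj : Function.Injective a)
    (ha_lim : Tendsto a atTop atTop) (ha_sum : ¬ Summable (fun k => 1 / a k))
    (htrans1 : ∀ k : ℕ,
      ∫⁻ ω, ENNReal.ofReal ((X ω + a k) ^ s) ∂μ
        = ∫⁻ ω, ENNReal.ofReal ((Y ω + a k) ^ s) ∂ν)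
    (htrans2 : ∀ k : ℕ,
      ∫⁻ ω, ENNReal.ofReal ((X ω + 2 * a k) ^ s) ∂μ
        = ∫⁻ ω, ENNReal.ofReal ((Y ω + 2 * a k) ^ s) ∂ν) :
    Measure.map X μ = Measure.map Y ν := by
  have hn' : (1 : ℝ) ≤ n := by exact_mod_cast hn
  have hs : 0 < s := by linarith
  have hiX : Integrable (fun ω => X ω ^ s) μ :=
    integrable_of_lint μ X hX hXnn s hmom_fin
  have hiY : Integrable (fun ω => Y ω ^ s) ν :=
    integrable_of_lint ν Y hY hYnn s (hmom_eq ▸ hmom_fin)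
  have hreal : ∀ k, ∫ ω, (X ω + a k) ^ s ∂μ = ∫ ω, (Y ω + a k) ^ s ∂ν := by
    intro k
    have hk := ha_pos k
    rw [integral_eq_lintegral_of_nonneg_ae
        (ae_of_all _ fun ω => by have := hXnn ω; simp only [Pi.zero_apply]; positivity)
        (Measurable.aestronglyMeasurable (by fun_prop)),
      integral_eq_lintegral_of_nonneg_ae
        (ae_of_all _ fun ω => by have := hYnn ω; simp only [Pi.zero_apply]; positivity)
        (Measurable.aestronglyMeasurable (by fun_prop)), htrans1 k]
  have hslit : ∀ z : ℂ, 0 < z.re → z + 1 ∈ Complex.slitPlane := by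
    intro z hz
    left; simp; linarith
  have hne : ∀ z : ℂ, 0 < z.re → (z + 1) ^ (s : ℂ) ≠ 0 := by
    intro z hz
    rw [Complex.cpow_ne_zero_iff]
    exact Or.inl (Complex.slitPlane_ne_zero (hslit z hz))
  have hzero : ∀ z : ℂ, 0 < z.re →
      ∫ ω, ((X ω : ℂ) + z) ^ (s : ℂ) ∂μ = ∫ ω, ((Y ω : ℂ) + z) ^ (s : ℂ) ∂ν := by
    intro z hz
    have := blaschke_zero ((∫ ω, (X ω + 1) ^ s ∂μ) + ∫ ω, (Y ω + 1) ^ s ∂ν)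
      (fun z => (∫ ω, ((X ω : ℂ) + z) ^ (s : ℂ) ∂μ - ∫ ω, ((Y ω : ℂ) + z) ^ (s : ℂ) ∂ν)
        / (z + 1) ^ (s : ℂ)) a ha_pos ha_inj ha_lim ha_sum ?_ ?_ ?_ z hz
    · rw [div_eq_zero_iff] at this
      exact sub_eq_zero.1 (this.resolve_right (hne z hz))
    · intro w hw
      apply DifferentiableAt.differentiableWithinAt
      apply DifferentiableAt.div
      · exact (hasDerivAt_G μ X hX hXnn s hs hiX s le_rfl w hw).differentiableAt.sub
          (hasDerivAt_G ν Y hY hYnn s hs hiY s le_rfl w hw).differentiableAt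
      · exact DifferentiableAt.cpow_const (by fun_prop) (hslit w hw)
      · exact hne w hw
    · intro w hw
      rw [norm_div, div_le_iff₀ (norm_pos_iff.2 (hne w hw)), add_mul]
      exact (norm_sub_le _ _).trans (add_le_add (G_growth μ X hX hXnn s hs hiX w hw)
        (G_growth ν Y hY hYnn s hs hiY w hw))
    · intro k
      rw [G_real μ X hXnn s _ (ha_pos k), G_real ν Y hYnn s _ (ha_pos k), hreal k]
      simp
  have hall : ∀ j : ℕ, ∀ z : ℂ, 0 < z.re →
      ∫ ω, ((X ω : ℂ) + z) ^ ((s - j : ℝ) : ℂ) ∂μ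
        = ∫ ω, ((Y ω : ℂ) + z) ^ ((s - j : ℝ) : ℂ) ∂ν := by
    intro j
    induction j with
    | zero => simpa using hzero
    | succ j ih =>
      intro z hz
      have hj : s - (j : ℝ) ≤ s := by have := Nat.cast_nonneg (α := ℝ) j; linarith
      have d1 := hasDerivAt_G μ X hX hXnn s hs hiX (s - j) hj z hz
      have d2 := hasDerivAt_G ν Y hY hYnn s hs hiY (s - j) hj z hz
      have hev : (fun z : ℂ => ∫ ω, ((X ω : ℂ) + z) ^ ((s - j : ℝ) : ℂ) ∂μ)
          =ᶠ[nhds z] (fun z : ℂ => ∫ ω, ((Y ω : ℂ) + z) ^ ((s - j : ℝ) : ℂ) ∂ν) := by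
        filter_upwards [(isOpen_lt continuous_const Complex.continuous_re).mem_nhds hz] with w hw
        exact ih w hw
      have heq := d1.unique (d2.congr_of_eventuallyEq hev)
      have hsj : s - (j : ℝ) ≠ 0 := by
        intro h
        have h' : s = j := by linarith
        rw [h'] at hs1 hs2
        have e1 : n < j := by exact_mod_cast hs1
        have e2 : j < n + 1 := by exact_mod_cast hs2
        omega
      have := mul_left_cancel₀ (Complex.ofReal_ne_zero.2 hsj) heq
      have e : s - ((j + 1 : ℕ) : ℝ) = s - j - 1 := by push_cast; ring
      rw [e]
      exact this
  have hmom : ∀ j : ℕ, ∫ ω, (X ω + 1) ^ (s - j) ∂μ = ∫ ω, (Y ω + 1) ^ (s - j) ∂ν := by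
    intro j
    have := hall j ((1 : ℝ) : ℂ) (by simp)
    rw [G_real μ X hXnn _ _ one_pos, G_real ν Y hYnn _ _ one_pos] at this
    exact Complex.ofReal_injective this
  have := wmeas_finite μ X s (integrable_shift μ X hX hXnn s hs hiX s le_rfl 1 one_pos)
  have := wmeas_finite ν Y s (integrable_shift ν Y hY hYnn s hs hiY s le_rfl 1 one_pos)
  have hw : wmeas μ X s = wmeas ν Y s := moments_ext _ _ (wmeas_supp μ X hX hXnn s)
    (wmeas_supp ν Y hY hYnn s) fun j => by
      rw [wmeas_moment μ X hX hXnn, wmeas_moment ν Y hY hYnn, hmom]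
  ext A hA
  rw [wmeas_recover μ X hX hXnn s A hA, wmeas_recover ν Y hY hYnn s A hA, hw]
end

section
/- Let X and Y be nonnegative random variables with E[X^s] = E[Y^s] ∈ (0,∞) for some s ∈ (0,1), and let p_j denote the j-th prime number. If either (i) E[(X+p_j)^s] = E[(Y+p_j)^s] for all j ≥ 1, or (ii) E[(X+1/p_j)^s] = E[(Y+1/p_j)^s] for all j ≥ 1, then X and Y have the same distribution. -/
open MeasureTheory Real Set Filter

lemma aux_factor (g : ℂ → ℂ) (M : ℝ) (hg : DifferentiableOn ℂ g {z | 0 < z.re})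
    (hM : ∀ z : ℂ, 0 < z.re → ‖g z‖ ≤ M) (a : ℝ) (ha : 0 < a) (hga : g a = 0) :
    ∃ g1 : ℂ → ℂ, DifferentiableOn ℂ g1 {z | 0 < z.re} ∧
      (∀ z : ℂ, 0 < z.re → ‖g1 z‖ ≤ M) ∧
      ∀ z : ℂ, 0 < z.re → g z = (z - a) / (z + a) * g1 z := by
  set φ : ℂ → ℂ := fun u => a * ((1 + u) / (1 - u)) with hφ
  set ψ : ℂ → ℂ := fun z => (z - a) / (z + a) with hψ
  have hne : ∀ u ∈ Metric.ball (0:ℂ) 1, (1 - u) ≠ 0 := by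
    intro u hu h
    rw [sub_eq_zero] at h
    rw [← h] at hu
    simp at hu
  have hφm : ∀ u ∈ Metric.ball (0:ℂ) 1, 0 < (φ u).re := by
    intro u hu
    have h1 := hne u hu
    have h2 : 0 < Complex.normSq (1 - u) := Complex.normSq_pos.2 h1
    have h3 : Complex.normSq u < 1 := by
      rw [mem_ball_zero_iff] at hu
      rw [Complex.normSq_eq_norm_sq]
      nlinarith [norm_nonneg u]
    have : (φ u).re = a * ((1 - Complex.normSq u) / Complex.normSq (1 - u)) := by
      simp only [hφ, Complex.re_ofReal_mul, Complex.div_re]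
      rw [← add_div]
      congr 2
      simp [Complex.normSq_apply]
      ring
    rw [this]
    have : 0 < 1 - Complex.normSq u := by linarith
    positivity
  have hzne : ∀ z : ℂ, 0 < z.re → z + a ≠ 0 := by
    intro z hz h
    have := congrArg Complex.re h
    simp at this
    linarith
  have hψm : ∀ z : ℂ, 0 < z.re → ψ z ∈ Metric.ball (0:ℂ) 1 := by
    intro z hz
    rw [mem_ball_zero_iff]
    simp only [hψ, norm_div]
    rw [div_lt_one (norm_pos_iff.2 (hzne z hz))]
    rw [← sq_lt_sq₀ (norm_nonneg _) (norm_nonneg _), ← Complex.normSq_eq_norm_sq,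
      ← Complex.normSq_eq_norm_sq]
    simp only [Complex.normSq_apply]
    simp
    nlinarith [mul_pos hz ha]
  have hφψ : ∀ z : ℂ, 0 < z.re → φ (ψ z) = z := by
    intro z hz
    have h0 := hzne z hz
    have h1 := hne _ (hψm z hz)
    have ha' : (a:ℂ) ≠ 0 := by exact_mod_cast ha.ne'
    simp only [hφ, hψ] at h1 ⊢
    have e1 : 1 - (z - a) / (z + a) = 2 * a / (z + a) := by field_simp; ring
    have e2 : 1 + (z - a) / (z + a) = 2 * z / (z + a) := by field_simp; ring
    rw [e1, e2]
    field_simp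
  set h : ℂ → ℂ := fun u => g (φ u) with hh
  have hφ0 : φ 0 = a := by simp [hφ]
  have hh0 : h 0 = 0 := by simp [hh, hφ0, hga]
  have hd : DifferentiableOn ℂ h (Metric.ball 0 1) := by
    refine hg.comp ?_ (fun u hu => hφm u hu)
    intro u hu
    have := hne u hu
    apply DifferentiableAt.differentiableWithinAt
    simp only [hφ]
    fun_prop (disch := assumption)
  have hmaps : MapsTo h (Metric.ball 0 1) (Metric.closedBall (h 0) M) := by
    intro u hu
    rw [hh0, mem_closedBall_zero_iff]
    exact hM _ (hφm u hu)
  refine ⟨fun z => dslope h 0 (ψ z), ?_, ?_, ?_⟩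
  · have hd' : DifferentiableOn ℂ (dslope h 0) (Metric.ball 0 1) :=
      (Complex.differentiableOn_dslope (Metric.ball_mem_nhds _ one_pos)).2 hd
    refine hd'.comp ?_ (fun z hz => hψm z hz)
    intro z hz
    have := hzne z hz
    apply DifferentiableAt.differentiableWithinAt
    simp only [hψ]
    fun_prop (disch := assumption)
  · intro z hz
    simpa using Complex.norm_dslope_le_div_of_mapsTo_ball hd hmaps (hψm z hz)
  · intro z hz
    have := sub_smul_dslope h 0 (ψ z)
    rw [hh0] at this
    simp only [sub_zero, smul_eq_mul] at this
    change g z = ψ z * _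
    rw [this]
    simp only [hh, hφψ z hz]

lemma aux_prod {ι : Type*} (a : ι → ℝ) (ha : ∀ i, 0 < a i) (hinj : Function.Injective a)
    (M : ℝ) (S : Finset ι) : ∀ (g : ℂ → ℂ), DifferentiableOn ℂ g {z | 0 < z.re} →
    (∀ z : ℂ, 0 < z.re → ‖g z‖ ≤ M) → (∀ i ∈ S, g (a i) = 0) →
    ∀ t : ℝ, 0 < t → ‖g t‖ ≤ M * ∏ i ∈ S, |(t - a i) / (t + a i)| := by
  classical
  induction S using Finset.induction_on with
  | empty => intro g _ hM _ t ht; simpa using hM t (by simpa using ht)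
  | insert i S hi ih =>
    intro g hg hM hz t ht
    obtain ⟨g1, h1, h2, h3⟩ := aux_factor g M hg hM (a i) (ha i) (hz i (by simp))
    have := ih g1 h1 h2 (fun j hj => by
      have hja := h3 (a j) (by simpa using ha j)
      rw [hz j (by simp [hj])] at hja
      rcases mul_eq_zero.1 hja.symm with h | h
      · exfalso
        rcases div_eq_zero_iff.1 h with h | h
        · have : a j = a i := by exact_mod_cast sub_eq_zero.1 h
          exact hi (hinj this ▸ hj)
        · have : a j + a i = 0 := by exact_mod_cast h
          linarith [ha i, ha j]
      · exact h) t ht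
    rw [Finset.prod_insert hi, h3 t (by simpa using ht), norm_mul]
    have e : ‖((t:ℂ) - a i) / (t + a i)‖ = |(t - a i) / (t + a i)| := by
      rw [← Real.norm_eq_abs, ← Complex.norm_real]; push_cast; rfl
    rw [e]
    calc _ ≤ |(t - a i) / (t + a i)| * (M * ∏ i ∈ S, |(t - a i) / (t + a i)|) := by gcongr
      _ = _ := by ring

lemma aux_vanish {ι : Type*} (a : ι → ℝ) (ha : ∀ i, 0 < a i) (hinj : Function.Injective a)
    (t : ℝ) (ht : 0 < t) (hns : ¬ Summable (fun i => min t (a i) / (t + a i)))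
    (M : ℝ) (g : ℂ → ℂ) (hg : DifferentiableOn ℂ g {z | 0 < z.re})
    (hM : ∀ z : ℂ, 0 < z.re → ‖g z‖ ≤ M) (hz : ∀ i, g (a i) = 0) : g t = 0 := by
  by_contra hne
  have hpos : 0 < ‖g t‖ := norm_pos_iff.2 hne
  have hM0 : 0 < M := hpos.trans_le (hM t (by simpa using ht))
  apply hns
  refine summable_of_sum_le (c := Real.log (M / ‖g t‖) / 2) (fun i => ?_) (fun S => ?_)
  · have := ha i
    positivity
  · have h1 := aux_prod a ha hinj M S g hg hM (fun i _ => hz i) t ht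
    have h2 : ∏ i ∈ S, |(t - a i) / (t + a i)| ≤
        Real.exp (- (2 * ∑ i ∈ S, min t (a i) / (t + a i))) := by
      rw [Finset.mul_sum, ← Finset.sum_neg_distrib, Real.exp_sum]
      refine Finset.prod_le_prod (fun _ _ => abs_nonneg _) (fun i _ => ?_)
      have hp : 0 < t + a i := add_pos ht (ha i)
      have : |(t - a i) / (t + a i)| = -(2 * (min t (a i) / (t + a i))) + 1 := by
        rw [abs_div, abs_of_pos hp]
        rcases le_total t (a i) with h | h
        · rw [min_eq_left h, abs_of_nonpos (by linarith)]; field_simp; ring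
        · rw [min_eq_right h, abs_of_nonneg (by linarith)]; field_simp; ring
      rw [this]
      exact Real.add_one_le_exp _
    have h3 : ‖g t‖ ≤ M * Real.exp (- (2 * ∑ i ∈ S, min t (a i) / (t + a i))) :=
      h1.trans (by gcongr)
    rw [Real.exp_neg, ← div_eq_mul_inv, le_div_iff₀ (Real.exp_pos _), mul_comm,
      ← le_div_iff₀ hpos, ← Real.le_log_iff_exp_le (by positivity)] at h3
    linarith

lemma aux_ns (t : ℝ) (ht : 0 < t) :
    ¬ Summable (fun p : Nat.Primes => min t (p:ℝ) / (t + p)) := by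
  intro h
  apply Nat.Primes.not_summable_one_div
  have h2 := h.mul_left ((t + 1) / t + (t + 1))
  refine Summable.of_nonneg_of_le (fun p => by positivity) (fun p => ?_) h2
  have hp : (2:ℝ) ≤ p := by exact_mod_cast p.2.two_le
  set q : ℝ := ((p:ℕ):ℝ) with hq
  have hq0 : 0 < q := by linarith
  rcases le_total t q with h | h
  · rw [min_eq_left h]
    calc 1 / q ≤ (t+1)/t * (t / (t + q)) := by
          rw [div_mul_div_cancel₀ ht.ne', div_le_div_iff₀ hq0 (by positivity)]
          nlinarith
      _ ≤ _ := by gcongr; linarith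
  · rw [min_eq_right h]
    calc 1 / q ≤ (t + 1) * (q / (t + q)) := by
          rw [← mul_div_assoc, div_le_div_iff₀ hq0 (by positivity)]
          nlinarith [mul_pos ht hq0, mul_pos hq0 hq0]
      _ ≤ _ := by
          have h4 : 0 < (t + 1) / t := by positivity
          apply mul_le_mul_of_nonneg_right _ (by positivity)
          linarith

lemma aux_norm_le (x : ℝ) (hx : 0 ≤ x) (z : ℂ) (c r : ℝ) (hc : 0 < c) (hz : c ≤ z.re)
    (hr : r ≤ 0) : ‖((x:ℂ) + z) ^ (r:ℂ)‖ ≤ c ^ r := by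
  rw [Complex.norm_cpow_real]
  apply Real.rpow_le_rpow_of_nonpos hc _ hr
  have := Complex.re_le_norm ((x:ℂ) + z)
  simp at this
  linarith

lemma aux_norm_le' (x : ℝ) (hx : 0 ≤ x) (z : ℂ) (s : ℝ) (hs1 : 0 < s) (hs2 : s < 1) :
    ‖((x:ℂ) + z) ^ (s:ℂ)‖ ≤ x ^ s + (1 + ‖z‖) := by
  rw [Complex.norm_cpow_real]
  have h1 : ‖(x:ℂ) + z‖ ≤ x + ‖z‖ := by
    refine (norm_add_le _ _).trans ?_
    simp [abs_of_nonneg hx]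
  calc ‖(x:ℂ) + z‖ ^ s ≤ (x + ‖z‖) ^ s := by gcongr
    _ ≤ x ^ s + ‖z‖ ^ s := Real.rpow_add_le_add_rpow hx (norm_nonneg _) hs1.le hs2.le
    _ ≤ x ^ s + (1 + ‖z‖) ^ s := by gcongr; linarith
    _ ≤ x ^ s + (1 + ‖z‖) := by
      gcongr
      exact Real.rpow_le_self_of_one_le (by linarith [norm_nonneg z]) hs2.le

lemma aux_meas {Ω : Type*} [MeasurableSpace Ω] (μ : Measure Ω) (X : Ω → ℝ) (hX : Measurable X)
    (z : ℂ) (r : ℝ) : AEStronglyMeasurable (fun ω => ((X ω:ℂ) + z) ^ (r:ℂ)) μ := by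
  apply Measurable.aestronglyMeasurable
  fun_prop

lemma aux_int {Ω : Type*} [MeasurableSpace Ω] (μ : Measure Ω) [IsProbabilityMeasure μ]
    (X : Ω → ℝ) (hX : Measurable X) (hXnn : ∀ ω, 0 ≤ X ω) (s : ℝ) (hs1 : 0 < s) (hs2 : s < 1)
    (hint : Integrable (fun ω => X ω ^ s) μ) (k : ℕ) (z : ℂ) (hz : 0 < z.re) :
    Integrable (fun ω => ((X ω:ℂ) + z) ^ ((s - k : ℝ):ℂ)) μ := by
  rcases Nat.eq_zero_or_pos k with rfl | hk
  · refine Integrable.mono' (hint.add (integrable_const (1 + ‖z‖))) (aux_meas μ X hX z _) ?_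
    refine Eventually.of_forall fun ω => ?_
    simpa using aux_norm_le' (X ω) (hXnn ω) z s hs1 hs2
  · have hk' : (1:ℝ) ≤ k := by exact_mod_cast hk
    refine Integrable.mono' (integrable_const (z.re ^ (s - k : ℝ))) (aux_meas μ X hX z _) ?_
    exact Eventually.of_forall fun ω => aux_norm_le (X ω) (hXnn ω) z _ _ hz le_rfl (by linarith)

lemma aux_deriv {Ω : Type*} [MeasurableSpace Ω] (μ : Measure Ω) [IsProbabilityMeasure μ]
    (X : Ω → ℝ) (hX : Measurable X) (hXnn : ∀ ω, 0 ≤ X ω) (s : ℝ) (hs1 : 0 < s) (hs2 : s < 1)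
    (hint : Integrable (fun ω => X ω ^ s) μ) (k : ℕ) (z : ℂ) (hz : 0 < z.re) :
    HasDerivAt (fun z : ℂ => ∫ ω, ((X ω:ℂ) + z) ^ ((s - k : ℝ):ℂ) ∂μ)
      (((s - k : ℝ):ℂ) * ∫ ω, ((X ω:ℂ) + z) ^ ((s - (k + 1 : ℕ) : ℝ):ℂ) ∂μ) z := by
  have hk0 : (0:ℝ) ≤ k := by positivity
  have hopen : {w : ℂ | z.re / 2 < w.re} ∈ nhds z :=
    (isOpen_lt continuous_const Complex.continuous_re).mem_nhds (by simp; linarith)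
  rw [← integral_const_mul]
  refine (hasDerivAt_integral_of_dominated_loc_of_deriv_le (𝕜 := ℂ)
    (F := fun (z:ℂ) ω => ((X ω:ℂ) + z) ^ ((s - k : ℝ):ℂ))
    (F' := fun (z:ℂ) ω => ((s - k : ℝ):ℂ) * ((X ω:ℂ) + z) ^ ((s - (k + 1 : ℕ) : ℝ):ℂ))
    (bound := fun _ => |s - k| * (z.re / 2) ^ (s - (k + 1 : ℕ) : ℝ))
    hopen (Eventually.of_forall fun z => aux_meas μ X hX z _)
    (aux_int μ X hX hXnn s hs1 hs2 hint k z hz) ((aux_meas μ X hX z _).const_mul _) ?_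
    (integrable_const _) ?_).2
  · refine Eventually.of_forall fun ω w hw => ?_
    rw [norm_mul, Complex.norm_real, Real.norm_eq_abs]
    gcongr
    exact aux_norm_le (X ω) (hXnn ω) w _ _ (by linarith) (le_of_lt hw) (by push_cast; linarith)
  · refine Eventually.of_forall fun ω w hw => ?_
    have hw' : 0 < w.re := by have : z.re / 2 < w.re := hw; linarith
    have h1 : HasDerivAt (fun w : ℂ => (X ω:ℂ) + w) 1 w := (hasDerivAt_id w).const_add _
    have h2 := h1.cpow_const (c := ((s - k : ℝ):ℂ)) (by
      left; simp; linarith [hXnn ω])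
    have e : ((s - k : ℝ):ℂ) * ((X ω:ℂ) + w) ^ ((s - (k + 1 : ℕ) : ℝ):ℂ) =
        ((s - k : ℝ):ℂ) * ((X ω:ℂ) + w) ^ (((s - k : ℝ):ℂ) - 1) * 1 := by
      rw [mul_one]
      congr 2
      push_cast; ring
    simp only [e]
    exact h2

lemma aux_zero_step {Ω Ω' : Type*} [MeasurableSpace Ω] [MeasurableSpace Ω']
    (μ : Measure Ω) (ν : Measure Ω') [IsProbabilityMeasure μ] [IsProbabilityMeasure ν]
    (X : Ω → ℝ) (Y : Ω' → ℝ) (hX : Measurable X) (hY : Measurable Y)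
    (hXnn : ∀ ω, 0 ≤ X ω) (hYnn : ∀ ω, 0 ≤ Y ω)
    (s : ℝ) (hs1 : 0 < s) (hs2 : s < 1)
    (hiX : Integrable (fun ω => X ω ^ s) μ) (hiY : Integrable (fun ω => Y ω ^ s) ν)
    (h0 : ∀ t : ℝ, 0 < t → ∫ ω, ((X ω:ℂ) + t) ^ (s:ℂ) ∂μ = ∫ ω, ((Y ω:ℂ) + t) ^ (s:ℂ) ∂ν)
    (k : ℕ) : ∀ t : ℝ, 0 < t → ∫ ω, ((X ω:ℂ) + t) ^ ((s - k : ℝ):ℂ) ∂μ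
      = ∫ ω, ((Y ω:ℂ) + t) ^ ((s - k : ℝ):ℂ) ∂ν := by
  induction k with
  | zero => simpa using h0
  | succ k ih =>
    intro t ht
    have d1 := (aux_deriv μ X hX hXnn s hs1 hs2 hiX k t (by simpa using ht)).comp_ofReal
    have d2 := (aux_deriv ν Y hY hYnn s hs1 hs2 hiY k t (by simpa using ht)).comp_ofReal
    have e := d1.congr_of_eventuallyEq (f₁ := fun t : ℝ => ∫ ω, ((Y ω:ℂ) + t) ^ ((s - k : ℝ):ℂ) ∂ν)
      (by filter_upwards [lt_mem_nhds ht] with u hu using (ih u hu).symm)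
    have := e.unique d2
    refine mul_left_cancel₀ ?_ this
    have : s - k ≠ 0 := by
      intro h
      have hk : s = k := by linarith
      rw [hk] at hs1 hs2
      norm_cast at hs1 hs2
      omega
    exact_mod_cast this

lemma aux_law {Ω : Type*} [MeasurableSpace Ω] (μ : Measure Ω) 
    (X : Ω → ℝ) (hX : Measurable X) (hXnn : ∀ ω, 0 ≤ X ω) (r : ℝ) (A : Set ℝ) (hA : MeasurableSet A) :
    Measure.map X μ A = ∫⁻ w, (A.indicator 1 (1 / w - 1)) * ENNReal.ofReal (w ^ r)
      ∂(Measure.map (fun ω => 1 / (X ω + 1)) (μ.withDensity (fun ω => ENNReal.ofReal ((X ω + 1) ^ r)))) := by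
  have hm : Measurable (A.indicator (1 : ℝ → ENNReal)) := measurable_one.indicator hA
  rw [lintegral_map (by fun_prop) (by fun_prop),
    lintegral_withDensity_eq_lintegral_mul _ (by fun_prop) (by fun_prop), 
    ← lintegral_indicator_one hA, lintegral_map hm hX]
  refine lintegral_congr fun ω => ?_
  have hp : 0 < X ω + 1 := by linarith [hXnn ω]
  have e : 1 / (1 / (X ω + 1)) - 1 = X ω := by rw [one_div_one_div]; ring
  simp only [Pi.mul_apply, e]
  rw [mul_left_comm, ← ENNReal.ofReal_mul (by positivity), ← Real.mul_rpow (by positivity) (by positivity)]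
  rw [mul_one_div_cancel hp.ne']
  simp

lemma aux_moment {Ω : Type*} [MeasurableSpace Ω] (μ : Measure Ω) [IsProbabilityMeasure μ]
    (X : Ω → ℝ) (hX : Measurable X) (hXnn : ∀ ω, 0 ≤ X ω) (s : ℝ) (k : ℕ) :
    ((∫ w, w ^ k ∂(Measure.map (fun ω => 1 / (X ω + 1)) (μ.withDensity (fun ω => ENNReal.ofReal ((X ω + 1) ^ (s - 1))))) : ℝ) : ℂ)
     = ∫ ω, ((X ω:ℂ) + (1:ℝ)) ^ ((s - (k + 1 : ℕ) : ℝ):ℂ) ∂μ := by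
  rw [integral_map (by fun_prop) (by fun_prop),
    integral_withDensity_eq_integral_toReal_smul (by fun_prop) (Eventually.of_forall fun _ => ENNReal.ofReal_lt_top),
    ← integral_complex_ofReal]
  refine integral_congr_ae (Eventually.of_forall fun ω => ?_)
  have hp : 0 < X ω + 1 := by linarith [hXnn ω]
  simp only
  rw [← Complex.ofReal_add, ← Complex.ofReal_cpow hp.le, ENNReal.toReal_ofReal (by positivity)]
  congr 1
  have : s - ((k+1:ℕ):ℝ) = (s - 1) - (k:ℝ) := by push_cast; ring
  rw [this, Real.rpow_sub hp (s - 1) (k:ℝ), Real.rpow_natCast, smul_eq_mul, div_pow, one_pow]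
  ring

lemma aux_det (ρ σ : Measure ℝ) [IsFiniteMeasure ρ] [IsFiniteMeasure σ]
    (hρ : ∀ᵐ w ∂ρ, w ∈ Icc (0:ℝ) 1) (hσ : ∀ᵐ w ∂σ, w ∈ Icc (0:ℝ) 1)
    (h : ∀ k : ℕ, ∫ w, w ^ k ∂ρ = ∫ w, w ^ k ∂σ) : ρ = σ := by
  have hpi : ∀ (τ : Measure ℝ) [IsFiniteMeasure τ] (_ : ∀ᵐ w ∂τ, w ∈ Icc (0:ℝ) 1) (k : ℕ),
      Integrable (fun w : ℝ => w ^ k) τ := by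
    intro τ _ hτ k
    refine Integrable.mono' (integrable_const (1:ℝ)) (by fun_prop) ?_
    filter_upwards [hτ] with w hw
    rw [Real.norm_eq_abs, abs_of_nonneg (pow_nonneg hw.1 _)]
    exact pow_le_one₀ hw.1 hw.2
  have hPi : ∀ (τ : Measure ℝ) [IsFiniteMeasure τ] (_ : ∀ᵐ w ∂τ, w ∈ Icc (0:ℝ) 1) (p : Polynomial ℝ),
      Integrable (fun w : ℝ => p.eval w) τ := by
    intro τ _ hτ p
    simp only [Polynomial.eval_eq_sum_range]
    exact integrable_finsetSum _ fun k _ => (hpi τ hτ k).const_mul _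
  have hP : ∀ p : Polynomial ℝ, ∫ w, p.eval w ∂ρ = ∫ w, p.eval w ∂σ := by
    intro p
    simp only [Polynomial.eval_eq_sum_range]
    rw [integral_finsetSum _ fun k _ => (hpi ρ hρ k).const_mul _,
      integral_finsetSum _ fun k _ => (hpi σ hσ k).const_mul _]
    simp only [integral_const_mul, h]
  have hest : ∀ (τ : Measure ℝ) [IsFiniteMeasure τ] (_ : ∀ᵐ w ∂τ, w ∈ Icc (0:ℝ) 1)
      (p : Polynomial ℝ) (f : BoundedContinuousFunction ℝ ℝ) (ε : ℝ),
      (∀ x ∈ Icc (0:ℝ) 1, |p.eval x - f x| < ε) →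
      |∫ w, p.eval w ∂τ - ∫ w, f w ∂τ| ≤ ε * τ.real univ := by
    intro τ _ hτ p f ε hp
    rw [← integral_sub (hPi τ hτ p) (f.integrable τ), ← Real.norm_eq_abs]
    apply norm_integral_le_of_norm_le_const
    filter_upwards [hτ] with w hw using (hp w hw).le
  apply ext_of_forall_integral_eq_of_IsFiniteMeasure
  intro f
  by_contra hne
  set d := |∫ x, f x ∂ρ - ∫ x, f x ∂σ| with hd
  have hdpos : 0 < d := abs_pos.2 (sub_ne_zero.2 hne)
  set m := ρ.real univ + σ.real univ + 1 with hm
  have hm0 : 0 < m := by positivity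
  obtain ⟨p, hp⟩ := exists_polynomial_near_of_continuousOn 0 1 f f.continuous.continuousOn (d / m)
    (by positivity)
  have e1 := hest ρ hρ p f _ hp
  have e2 := hest σ hσ p f _ hp
  rw [hP p] at e1
  have e3 : d ≤ d / m * ρ.real univ + d / m * σ.real univ := by
    have := abs_sub_le (∫ x, f x ∂ρ) (∫ w, p.eval w ∂σ) (∫ x, f x ∂σ)
    rw [abs_sub_comm (∫ x, f x ∂ρ) (∫ w, p.eval w ∂σ)] at this
    linarith
  have e4 : d / m * m = d := by field_simp
  have : 0 < d / m := by positivity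
  rw [hm] at e4
  nlinarith

lemma aux_conv {Ω : Type*} [MeasurableSpace Ω] (μ : Measure Ω)
    (X : Ω → ℝ) (hX : Measurable X) (hXnn : ∀ ω, 0 ≤ X ω) (s : ℝ) (a : ℝ) (ha : 0 < a) :
    ∫ ω, ((X ω:ℂ) + a) ^ (s:ℂ) ∂μ = ((∫⁻ ω, ENNReal.ofReal ((X ω + a) ^ s) ∂μ).toReal : ℂ) := by
  have hp : ∀ ω, 0 ≤ X ω + a := fun ω => by linarith [hXnn ω]
  rw [← integral_eq_lintegral_of_nonneg_ae
    (Eventually.of_forall fun ω => Real.rpow_nonneg (hp ω) s)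
      (Measurable.aestronglyMeasurable (by fun_prop)),
    ← integral_complex_ofReal]
  refine integral_congr_ae (Eventually.of_forall fun ω => ?_)
  simp only
  rw [Complex.ofReal_cpow (hp ω), Complex.ofReal_add]

lemma aux_bound {Ω : Type*} [MeasurableSpace Ω] (μ : Measure Ω) [IsProbabilityMeasure μ]
    (X : Ω → ℝ) (hXnn : ∀ ω, 0 ≤ X ω) (s : ℝ) (hs1 : 0 < s) (hs2 : s < 1)
    (hint : Integrable (fun ω => X ω ^ s) μ) (z : ℂ) :
    ‖∫ ω, ((X ω:ℂ) + z) ^ (s:ℂ) ∂μ‖ ≤ (∫ ω, X ω ^ s ∂μ) + (1 + ‖z‖) := by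
  have h := norm_integral_le_of_norm_le (hint.add (integrable_const (μ := μ) (1 + ‖z‖)))
    (Eventually.of_forall fun ω => aux_norm_le' (X ω) (hXnn ω) z s hs1 hs2)
  refine h.trans (le_of_eq ?_)
  simp only [Pi.add_apply]
  rw [integral_add hint (integrable_const _)]
  simp

lemma aux_main {Ω Ω' : Type*} [MeasurableSpace Ω] [MeasurableSpace Ω']
    (μ : Measure Ω) (ν : Measure Ω') [IsProbabilityMeasure μ] [IsProbabilityMeasure ν]
    (X : Ω → ℝ) (Y : Ω' → ℝ) (hX : Measurable X) (hY : Measurable Y)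
    (hXnn : ∀ ω, 0 ≤ X ω) (hYnn : ∀ ω, 0 ≤ Y ω)
    (s : ℝ) (hs1 : 0 < s) (hs2 : s < 1)
    (hiX : Integrable (fun ω => X ω ^ s) μ) (hiY : Integrable (fun ω => Y ω ^ s) ν)
    {ι : Type*} (a : ι → ℝ) (ha : ∀ i, 0 < a i) (hinj : Function.Injective a)
    (hns : ∀ t : ℝ, 0 < t → ¬ Summable (fun i => min t (a i) / (t + a i)))
    (heq : ∀ i, ∫⁻ ω, ENNReal.ofReal ((X ω + a i) ^ s) ∂μ
      = ∫⁻ ω, ENNReal.ofReal ((Y ω + a i) ^ s) ∂ν) :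
    Measure.map X μ = Measure.map Y ν := by
  have h0 : ∀ t : ℝ, 0 < t →
      ∫ ω, ((X ω:ℂ) + t) ^ (s:ℂ) ∂μ = ∫ ω, ((Y ω:ℂ) + t) ^ (s:ℂ) ∂ν := by
    intro t ht
    set f : ℂ → ℂ := fun z => (∫ ω, ((X ω:ℂ) + z) ^ (s:ℂ) ∂μ) - ∫ ω, ((Y ω:ℂ) + z) ^ (s:ℂ) ∂ν
      with hf
    set mX := ∫ ω, X ω ^ s ∂μ with hmX
    set mY := ∫ ω, Y ω ^ s ∂ν with hmY
    have hmX0 : 0 ≤ mX := integral_nonneg fun ω => Real.rpow_nonneg (hXnn ω) s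
    have hmY0 : 0 ≤ mY := integral_nonneg fun ω => Real.rpow_nonneg (hYnn ω) s
    have hz1 : ∀ z : ℂ, 0 < z.re → z + 1 ≠ 0 := by
      intro z hz h
      have := congrArg Complex.re h
      simp at this
      linarith
    have key := aux_vanish a ha hinj t ht (hns t ht) (mX + mY + 4) (fun z => f z / (z + 1))
      (by
        intro z hz
        have d1 := (aux_deriv μ X hX hXnn s hs1 hs2 hiX 0 z hz).differentiableAt
        have d2 := (aux_deriv ν Y hY hYnn s hs1 hs2 hiY 0 z hz).differentiableAt
        simp only [Nat.cast_zero, sub_zero] at d1 d2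
        apply DifferentiableAt.differentiableWithinAt
        exact (d1.sub d2).div (by fun_prop) (hz1 z hz))
      (by
        intro z hz
        rw [norm_div, div_le_iff₀ (norm_pos_iff.2 (hz1 z hz))]
        have b1 := aux_bound μ X hXnn s hs1 hs2 hiX z
        have b2 := aux_bound ν Y hYnn s hs1 hs2 hiY z
        have b3 : ‖f z‖ ≤ _ := norm_sub_le _ _
        have n1 : 1 ≤ ‖z + 1‖ := by
          have := Complex.re_le_norm (z + 1)
          simp at this
          linarith
        have n2 : ‖z‖ ≤ ‖z + 1‖ := by
          rw [← sq_le_sq₀ (norm_nonneg _) (norm_nonneg _), ← Complex.normSq_eq_norm_sq,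
            ← Complex.normSq_eq_norm_sq]
          simp only [Complex.normSq_apply]
          simp
          have : 0 < z.re := hz
          nlinarith
        nlinarith)
      (by
        intro i
        simp only [hf]
        rw [aux_conv μ X hX hXnn s _ (ha i), aux_conv ν Y hY hYnn s _ (ha i), heq i]
        simp)
    rcases div_eq_zero_iff.1 key with h | h
    · exact sub_eq_zero.1 h
    · exact absurd h (hz1 t (by simpa using ht))
  have hk := aux_zero_step μ ν X Y hX hY hXnn hYnn s hs1 hs2 hiX hiY h0
  have hfin : ∀ {Ω : Type _} [MeasurableSpace Ω] (μ : Measure Ω) [IsProbabilityMeasure μ]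
      (X : Ω → ℝ) (_ : Measurable X) (_ : ∀ ω, 0 ≤ X ω),
      IsFiniteMeasure (μ.withDensity (fun ω => ENNReal.ofReal ((X ω + 1) ^ (s - 1)))) := by
    intro Ω _ μ _ X hX hXnn
    apply isFiniteMeasure_withDensity
    apply ne_of_lt
    calc _ ≤ ∫⁻ ω, 1 ∂μ := by
          refine lintegral_mono fun ω => ?_
          rw [← ENNReal.ofReal_one]
          apply ENNReal.ofReal_le_ofReal
          exact Real.rpow_le_one_of_one_le_of_nonpos (by linarith [hXnn ω]) (by linarith)
      _ < ⊤ := by simp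
  have hfin' : ∀ {Ω : Type _} [MeasurableSpace Ω] (μ : Measure Ω) [IsProbabilityMeasure μ]
      (X : Ω → ℝ) (_ : Measurable X) (_ : ∀ ω, 0 ≤ X ω),
      IsFiniteMeasure (μ.withDensity (fun ω => ENNReal.ofReal ((X ω + 1) ^ (s - 1)))) := by
    intro Ω _ μ _ X hX hXnn
    apply isFiniteMeasure_withDensity
    apply ne_of_lt
    calc _ ≤ ∫⁻ ω, 1 ∂μ := by
          refine lintegral_mono fun ω => ?_
          rw [← ENNReal.ofReal_one]
          apply ENNReal.ofReal_le_ofReal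
          exact Real.rpow_le_one_of_one_le_of_nonpos (by linarith [hXnn ω]) (by linarith)
      _ < ⊤ := by simp
  have := hfin μ X hX hXnn
  have := hfin' ν Y hY hYnn
  have hI : ∀ x : ℝ, 0 ≤ x → 1 / (x + 1) ∈ Icc (0:ℝ) 1 := by
    intro x hx
    exact ⟨by positivity, by rw [div_le_one (by positivity)]; linarith⟩
  have hdet := aux_det
    (Measure.map (fun ω => 1 / (X ω + 1))
      (μ.withDensity (fun ω => ENNReal.ofReal ((X ω + 1) ^ (s - 1)))))
    (Measure.map (fun ω => 1 / (Y ω + 1))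
      (ν.withDensity (fun ω => ENNReal.ofReal ((Y ω + 1) ^ (s - 1)))))
    (by
      refine (ae_map_iff (p := fun w => w ∈ Icc (0:ℝ) 1) (by fun_prop) measurableSet_Icc).2 ?_
      exact Eventually.of_forall fun ω => hI _ (hXnn ω))
    (by
      refine (ae_map_iff (p := fun w => w ∈ Icc (0:ℝ) 1) (by fun_prop) measurableSet_Icc).2 ?_
      exact Eventually.of_forall fun ω => hI _ (hYnn ω))
    (by
      intro k
      have := hk (k + 1) 1 one_pos
      rw [← aux_moment μ X hX hXnn, ← aux_moment ν Y hY hYnn] at this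
      exact_mod_cast this)
  ext A hA
  rw [aux_law μ X hX hXnn (s - 1) A hA, aux_law ν Y hY hYnn (s - 1) A hA, hdet]

theorem stmt15 {Ω Ω' : Type*} [MeasurableSpace Ω] [MeasurableSpace Ω']
    (μ : Measure Ω) (ν : Measure Ω') [IsProbabilityMeasure μ] [IsProbabilityMeasure ν]
    (X : Ω → ℝ) (Y : Ω' → ℝ) (hX : Measurable X) (hY : Measurable Y)
    (hXnn : ∀ ω, 0 ≤ X ω) (hYnn : ∀ ω, 0 ≤ Y ω)
    (s : ℝ) (hs1 : 0 < s) (hs2 : s < 1)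
    (hmom_eq : ∫⁻ ω, ENNReal.ofReal (X ω ^ s) ∂μ = ∫⁻ ω, ENNReal.ofReal (Y ω ^ s) ∂ν)
    (hmom_pos : ∫⁻ ω, ENNReal.ofReal (X ω ^ s) ∂μ ≠ 0)
    (hmom_fin : ∫⁻ ω, ENNReal.ofReal (X ω ^ s) ∂μ ≠ ⊤)
    (htrans :
      (∀ j : ℕ,
        ∫⁻ ω, ENNReal.ofReal ((X ω + (Nat.nth Nat.Prime j : ℝ)) ^ s) ∂μ
          = ∫⁻ ω, ENNReal.ofReal ((Y ω + (Nat.nth Nat.Prime j : ℝ)) ^ s) ∂ν)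
      ∨ (∀ j : ℕ,
        ∫⁻ ω, ENNReal.ofReal ((X ω + 1 / (Nat.nth Nat.Prime j : ℝ)) ^ s) ∂μ
          = ∫⁻ ω, ENNReal.ofReal ((Y ω + 1 / (Nat.nth Nat.Prime j : ℝ)) ^ s) ∂ν)) :
    Measure.map X μ = Measure.map Y ν := by
  have fin : ∀ {Ω : Type _} [MeasurableSpace Ω] (μ : Measure Ω) (X : Ω → ℝ) (_ : Measurable X)
      (_ : ∀ ω, 0 ≤ X ω) (_ : ∫⁻ ω, ENNReal.ofReal (X ω ^ s) ∂μ ≠ ⊤),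
      Integrable (fun ω => X ω ^ s) μ := by
    intro Ω _ μ X hX hXnn h
    refine ⟨Measurable.aestronglyMeasurable (by fun_prop), ?_⟩
    rw [hasFiniteIntegral_iff_ofReal (Eventually.of_forall fun ω => Real.rpow_nonneg (hXnn ω) s)]
    exact lt_top_iff_ne_top.2 h
  have fin' : ∀ {Ω : Type _} [MeasurableSpace Ω] (μ : Measure Ω) (X : Ω → ℝ) (_ : Measurable X)
      (_ : ∀ ω, 0 ≤ X ω) (_ : ∫⁻ ω, ENNReal.ofReal (X ω ^ s) ∂μ ≠ ⊤),
      Integrable (fun ω => X ω ^ s) μ := by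
    intro Ω _ μ X hX hXnn h
    refine ⟨Measurable.aestronglyMeasurable (by fun_prop), ?_⟩
    rw [hasFiniteIntegral_iff_ofReal (Eventually.of_forall fun ω => Real.rpow_nonneg (hXnn ω) s)]
    exact lt_top_iff_ne_top.2 h
  have hiX := fin μ X hX hXnn hmom_fin
  have hiY := fin' ν Y hY hYnn (hmom_eq ▸ hmom_fin)
  have hp0 : ∀ p : Nat.Primes, (0:ℝ) < p := fun p => by exact_mod_cast p.2.pos
  have hinj : Function.Injective (fun p : Nat.Primes => (p:ℝ)) := by
    intro p q h
    apply Subtype.ext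
    have h' : ((p:ℕ):ℝ) = ((q:ℕ):ℝ) := h
    exact_mod_cast h'
  have hnth : ∀ p : Nat.Primes, Nat.nth Nat.Prime (Nat.count Nat.Prime p) = p :=
    fun p => Nat.nth_count p.2
  rcases htrans with h | h
  · refine aux_main μ ν X Y hX hY hXnn hYnn s hs1 hs2 hiX hiY (fun p : Nat.Primes => (p:ℝ))
      hp0 hinj aux_ns (fun p => ?_)
    have := h (Nat.count Nat.Prime p)
    rw [hnth] at this
    exact this
  · refine aux_main μ ν X Y hX hY hXnn hYnn s hs1 hs2 hiX hiY (fun p : Nat.Primes => 1 / (p:ℝ))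
      (fun p => one_div_pos.2 (hp0 p)) (fun p q hpq => hinj ?_) (fun t ht hsum => ?_) (fun p => ?_)
    · simpa using hpq
    · apply aux_ns (1 / t) (by positivity)
      refine hsum.congr fun p => ?_
      have := hp0 p
      have e1 : min t (1 / (p:ℝ)) = (t / p) * min (p:ℝ) (1 / t) := by
        rw [mul_min_of_nonneg _ _ (by positivity)]
        congr 1 <;> field_simp
      rw [e1, min_comm]
      field_simp
      try ring
    · have := h (Nat.count Nat.Prime p)
      rw [hnth] at this
      exact this
end
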